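/- arXiv:2104.03950 — 3 statements merged into one kernel-verified Lean document; each statement's English description precedes it below -/
import Mathlib

section
/- Let K >= 5 be an odd integer, and set a = 2K-3, c = 4K^2 - 16K + 11, d = 2K-5, and m = ceil(K^2 - (7/2)K + 2). Let Delta_K be the closed triangle in R^2 with vertices (0,0), (m-K+2, 0), and ((K-1)/2 + 1/c)*(d, a). Then the number of integer lattice points contained in Delta_K is exactly m(m+1)/2 + 1. -/
theorem mem_convexHull_triangle_iff {B p q x y : ℝ} (hB : 0 < B) (hq : 0 < q) :
    (x, y) ∈ convexHull ℝ ({((0 : ℝ), (0 : ℝ)), (B, 0), (p, q)} : Set (ℝ × ℝ)) ↔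
      0 ≤ y ∧ p * y ≤ q * x ∧ q * (x - B) ≤ (p - B) * y := by
  rw [convexHull_insert (by simp), convexHull_pair, convexJoin_singleton_left]
  simp only [Set.mem_iUnion, segment, Set.mem_ofPred_eq, exists_prop, Prod.ext_iff,
    Prod.fst_add, Prod.snd_add, Prod.smul_fst, Prod.smul_snd, smul_eq_mul, Prod.exists]
  constructor
  · rintro ⟨u, v, ⟨α, β, hα, hβ, hαβ, rfl, rfl⟩, γ, δ, hγ, hδ, hγδ, rfl, rfl⟩
    obtain rfl : γ = 1 - δ := by linarith
    obtain rfl : α = 1 - β := by linarith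
    refine ⟨by positivity, ?_, ?_⟩
    · have : 0 ≤ q * δ * (1 - β) * B := by positivity
      linarith
    · have : 0 ≤ q * B * (1 - δ) := by positivity
      linarith
  · rintro ⟨hy, hl, hr⟩
    have hqB : 0 < q * B := by positivity
    have hw : 0 ≤ y / q + (q * x - p * y) / (q * B) := by
      have : 0 ≤ q * x - p * y := by linarith
      positivity
    rcases hw.eq_or_lt with h0 | h0
    · have h1 : 0 ≤ y / q := by positivity
      have h2 : 0 ≤ (q * x - p * y) / (q * B) := div_nonneg (by linarith) hqB.le
      have hy0 : y = 0 := by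
        have : y / q = 0 := by linarith
        simpa [hq.ne'] using this
      have hx0 : x = 0 := by
        have : (q * x - p * y) / (q * B) = 0 := by linarith
        simpa [hq.ne', hB.ne', hy0] using this
      exact ⟨B, 0, ⟨1, 0, by simp⟩, 1, 0, by simp [hx0, hy0]⟩
    · obtain ⟨w, hsum⟩ : ∃ w, w = y / q + (q * x - p * y) / (q * B) := ⟨_, rfl⟩
      rw [← hsum] at h0
      have hw1 : w ≤ 1 := by
        rw [hsum, div_add_div _ _ hq.ne' hqB.ne', div_le_one (by positivity)]
        nlinarith
      refine ⟨x / w, y / w,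
        ⟨(q * x - p * y) / (q * B) / w, y / q / w, ?_, by positivity, ?_, ?_, ?_⟩,
        1 - w, w, by linarith, h0.le, by ring, ?_, ?_⟩
      · exact div_nonneg (div_nonneg (by linarith) hqB.le) h0.le
      · rw [← add_div, add_comm, ← hsum, div_self h0.ne']
      · field_simp
        ring
      · field_simp
        ring
      · field_simp
        ring
      · field_simp
        ring

theorem sum_floor_two_mul_div_block (k t j : ℕ) (hj : j ≤ k) :
    ∑ r ∈ Finset.range (k + 1 + j),
        2 * ((t * (2 * k + 1) + r : ℕ) : ℤ) / (2 * k + 1) =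
      2 * t * (k + 1) + (2 * t + 1) * j := by
  rw [Finset.sum_range_add]
  have low : ∀ r ∈ Finset.range (k + 1),
      2 * ((t * (2 * k + 1) + r : ℕ) : ℤ) / (2 * k + 1) = 2 * t := by
    intro r hr
    rw [Finset.mem_range] at hr
    rw [Int.ediv_eq_iff_of_pos (by positivity)]
    push_cast
    constructor <;> nlinarith
  have high : ∀ r ∈ Finset.range j,
      2 * ((t * (2 * k + 1) + (k + 1 + r) : ℕ) : ℤ) / (2 * k + 1) = 2 * t + 1 := by
    intro r hr
    rw [Finset.mem_range] at hr
    rw [Int.ediv_eq_iff_of_pos (by positivity)]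
    push_cast
    constructor <;> nlinarith
  rw [Finset.sum_congr rfl low, Finset.sum_congr rfl high]
  simp
  ring

theorem sum_floor_two_mul_div (k t : ℕ) :
    ∑ y ∈ Finset.range (t * (2 * k + 1)), 2 * (y : ℤ) / (2 * k + 1) =
      (2 * k + 1) * t * (t - 1) + t * k := by
  induction t with
  | zero => simp
  | succ t ih =>
    rw [show (t + 1) * (2 * k + 1) = t * (2 * k + 1) + (k + 1 + k) by ring,
      Finset.sum_range_add, ih, sum_floor_two_mul_div_block k t k le_rfl]
    push_cast
    ring

theorem ncard_triangle (n : ℕ) (hn : 1 ≤ n) :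
    2 * (Set.ncard {z : ℤ × ℤ | 0 ≤ z.2 ∧ (4 * n + 1) * z.2 ≤ (4 * n + 3) * z.1 ∧
      (4 * n + 5) * (z.1 - (4 * n + 3) * n) ≤ 2 * z.2} : ℤ) =
      (4 * n ^ 2 + 5 * n + 1) * (4 * n ^ 2 + 5 * n + 1 + 1) + 2 := by
  set N : ℕ := (n + 1) * (4 * n + 3) with hN
  have hnZ : (1 : ℤ) ≤ n := by exact_mod_cast hn
  let row : ℕ → Finset ℤ := fun y =>
    Finset.Icc ((y : ℤ) - 2 * y / (4 * n + 3)) ((4 * n + 3) * n + 2 * y / (4 * n + 5))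
  have hset : {z : ℤ × ℤ | 0 ≤ z.2 ∧ (4 * n + 1) * z.2 ≤ (4 * n + 3) * z.1 ∧
      (4 * n + 5) * (z.1 - (4 * n + 3) * n) ≤ 2 * z.2} =
      (((Finset.range (N + 1)).sigma row).image fun s => (s.2, (s.1 : ℤ)) : Set (ℤ × ℤ)) := by
    ext ⟨x, y⟩
    simp only [Set.mem_ofPred_eq, Finset.coe_image, Set.mem_image, Finset.mem_coe,
      Finset.mem_sigma, Finset.mem_range, Sigma.exists, Prod.mk.injEq, row, Finset.mem_Icc]
    have key : ∀ y : ℤ, (y - 2 * y / (4 * n + 3) ≤ x ∧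
        x ≤ (4 * n + 3) * n + 2 * y / (4 * n + 5)) ↔
        ((4 * n + 1) * y ≤ (4 * n + 3) * x ∧ (4 * n + 5) * (x - (4 * n + 3) * n) ≤ 2 * y) := by
      intro y
      rw [sub_le_comm, Int.le_ediv_iff_mul_le (by positivity), ← sub_le_iff_le_add',
        Int.le_ediv_iff_mul_le (by positivity)]
      constructor <;> rintro ⟨h1, h2⟩ <;> constructor <;> linarith
    constructor
    · rintro ⟨hy, h⟩
      lift y to ℕ using hy
      refine ⟨y, x, ⟨?_, (key y).2 h⟩, rfl, rfl⟩
      obtain ⟨h1, h2⟩ := h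
      zify
      rw [hN]
      push_cast
      by_contra! hlt
      nlinarith [mul_le_mul_of_nonneg_left h1 (show (0 : ℤ) ≤ 4 * n + 5 by positivity),
        mul_le_mul_of_nonneg_left h2 (show (0 : ℤ) ≤ 4 * n + 3 by positivity),
        mul_le_mul_of_nonneg_left hlt (show (0 : ℤ) ≤ 16 * n ^ 2 + 16 * n - 1 by nlinarith)]
    · rintro ⟨y, x, ⟨-, h⟩, rfl, rfl⟩
      exact ⟨by positivity, (key y).1 h⟩
  have hinj : Function.Injective fun s : (Σ _ : ℕ, ℤ) => (s.2, (s.1 : ℤ)) := by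
    rintro ⟨y, x⟩ ⟨y', x'⟩ h
    simp only [Prod.mk.injEq, Nat.cast_inj] at h
    rw [h.1, h.2]
  have hrow : ∀ y ∈ Finset.range (N + 1), ((row y).card : ℤ) =
      (4 * n + 3) * n + 1 - y + 2 * y / (4 * n + 5) + 2 * y / (4 * n + 3) := by
    intro y hy
    have hyN : (y : ℤ) ≤ (n + 1) * (4 * n + 3) := by
      have := Finset.mem_range_succ_iff.1 hy
      rw [hN] at this
      exact_mod_cast this
    rw [Int.card_Icc, Int.toNat_of_nonneg]
    · ring
    have h5 := Int.lt_ediv_add_one_mul_self (2 * (y : ℤ)) (show (0 : ℤ) < 4 * n + 5 by positivity)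
    have h3 := Int.lt_ediv_add_one_mul_self (2 * (y : ℤ)) (show (0 : ℤ) < 4 * n + 3 by positivity)
    generalize 2 * (y : ℤ) / (4 * n + 5) = u at *
    generalize 2 * (y : ℤ) / (4 * n + 3) = v at *
    by_contra! hlt
    have hlt' := Int.add_one_le_iff.2 hlt
    nlinarith [mul_le_mul_of_nonneg_left (Int.add_one_le_iff.2 h5)
        (show (0 : ℤ) ≤ 4 * n + 3 by positivity),
      mul_le_mul_of_nonneg_left (Int.add_one_le_iff.2 h3)
        (show (0 : ℤ) ≤ 4 * n + 5 by positivity),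
      mul_le_mul_of_nonneg_left hlt' (show (0 : ℤ) ≤ (4 * n + 5) * (4 * n + 3) by positivity),
      mul_le_mul_of_nonneg_left hyN (show (0 : ℤ) ≤ 16 * n ^ 2 + 16 * n - 1 by nlinarith)]
  have h3 : ∑ y ∈ Finset.range (N + 1), 2 * (y : ℤ) / (4 * n + 3) =
      (4 * n + 3) * (n + 1) * n + (n + 1) * (2 * n + 1) + 2 * (n + 1) := by
    have h := sum_floor_two_mul_div (2 * n + 1) (n + 1)
    have hlast : 2 * (N : ℤ) / (4 * n + 3) = 2 * (n + 1) := by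
      rw [hN]
      push_cast
      rw [← mul_assoc, Int.mul_ediv_cancel _ (by positivity)]
    rw [Finset.sum_range_succ, hlast, hN]
    rw [show 2 * (2 * n + 1) + 1 = 4 * n + 3 by ring] at h
    push_cast at h
    rw [show (2 * (2 * n + 1) + 1 : ℤ) = 4 * n + 3 by ring] at h
    rw [h]
    ring
  have h5 : ∑ y ∈ Finset.range (N + 1), 2 * (y : ℤ) / (4 * n + 5) =
      (4 * n + 5) * n * (n - 1) + n * (2 * n + 2) + 2 * n * (2 * n + 3) + (2 * n + 1) := by
    have h := sum_floor_two_mul_div (2 * n + 2) n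
    have h' := sum_floor_two_mul_div_block (2 * n + 2) n 1 (by omega)
    rw [show N + 1 = n * (2 * (2 * n + 2) + 1) + (2 * n + 2 + 1 + 1) by rw [hN]; ring,
      Finset.sum_range_add,
      show (4 * n + 5 : ℤ) = 2 * ((2 * n + 2 : ℕ) : ℤ) + 1 by push_cast; ring, h, h']
    push_cast
    ring
  have hid : 2 * ∑ y ∈ Finset.range (N + 1), (y : ℤ) = (N + 1) * N := by
    have := Finset.sum_range_id_mul_two (N + 1)
    zify at this
    simpa [mul_comm] using this
  rw [hset, Set.ncard_coe_finset, Finset.card_image_of_injective _ hinj, Finset.card_sigma]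
  push_cast
  rw [Finset.sum_congr rfl hrow, Finset.sum_add_distrib, Finset.sum_add_distrib,
    Finset.sum_sub_distrib, h3, h5, Finset.sum_const, Finset.card_range, nsmul_eq_mul]
  have hNZ : (N : ℤ) = (n + 1) * (4 * n + 3) := by rw [hN]; push_cast; ring
  rw [hNZ] at hid
  push_cast
  rw [hNZ]
  linear_combination -hid

theorem stmt3 (K : ℤ) (hK : 5 ≤ K) (hKodd : Odd K)
    (a c d : ℤ) (m : ℕ) (ha : a = 2 * K - 3) (hc : c = 4 * K ^ 2 - 16 * K + 11)
    (hd : d = 2 * K - 5)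
    (hm : 2 * (m : ℤ) = 2 * K ^ 2 - 7 * K + 5) :
    2 * Set.ncard {z : ℤ × ℤ |
        ((z.1 : ℝ), (z.2 : ℝ)) ∈ convexHull ℝ
          ({((0 : ℝ), (0 : ℝ)), ((m : ℝ) - (K : ℝ) + 2, 0),
            (((K : ℝ) - 1) / 2 + 1 / (c : ℝ)) • ((d : ℝ), (a : ℝ))} : Set (ℝ × ℝ))} =
      m * (m + 1) + 2 := by
  obtain ⟨n, rfl⟩ : ∃ n : ℕ, K = 2 * n + 3 := by
    obtain ⟨k, rfl⟩ := hKodd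
    exact ⟨(k - 1).toNat, by omega⟩
  have hn : 1 ≤ n := by omega
  have hnR : (1 : ℝ) ≤ n := by exact_mod_cast hn
  obtain rfl : m = 4 * n ^ 2 + 5 * n + 1 := by
    zify
    linarith
  subst ha hc hd
  obtain ⟨D, hD⟩ : ∃ D : ℝ, D = 16 * n ^ 2 + 16 * n - 1 := ⟨_, rfl⟩
  have hDpos : 0 < D := by nlinarith
  have hset := ncard_triangle n hn
  zify
  rw [← hset]
  congr 3
  ext ⟨x, y⟩
  have hB : (4 * (n : ℝ) ^ 2 + 5 * n + 1 - (2 * n + 3) + 2) = (4 * n + 3) * n := by ring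
  have ht : ((2 * n + 3 : ℝ) - 1) / 2 + 1 / (4 * (2 * n + 3) ^ 2 - 16 * (2 * n + 3) + 11) =
      (4 * n + 3) * (4 * n + 5) * n / D := by
    rw [show (4 * (2 * n + 3) ^ 2 - 16 * (2 * n + 3) + 11 : ℝ) = D by rw [hD]; ring]
    field_simp
    rw [hD]
    ring
  simp only [Set.mem_ofPred_eq, Prod.smul_mk, smul_eq_mul]
  rw [hB, ht, show (2 * (2 * n + 3) - 5 : ℝ) = 4 * n + 1 by ring,
    show (2 * (2 * n + 3) - 3 : ℝ) = 4 * n + 3 by ring,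
    mem_convexHull_triangle_iff (by positivity) (by positivity)]
  have e1 : ∀ s : ℝ, 0 < s → (s * (4 * n + 1) * (y : ℝ) ≤ s * (4 * n + 3) * x ↔
      (4 * n + 1) * (y : ℝ) ≤ (4 * n + 3) * x) := fun s hs => by
    rw [mul_assoc, mul_assoc, mul_le_mul_iff_right₀ hs]
  have e2 : (4 * n + 3) * (4 * n + 5) * n / D * (4 * n + 3) *
        ((x : ℝ) - (4 * n + 3) * n) ≤
      ((4 * n + 3) * (4 * n + 5) * n / D * (4 * n + 1) -
        (4 * n + 3) * n) * y ↔ (4 * n + 5) * ((x : ℝ) - (4 * n + 3) * n) ≤ 2 * y := by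
    have hs : (0 : ℝ) < (4 * n + 3) ^ 2 * n / D := by positivity
    rw [← mul_le_mul_iff_right₀ hs (b := (4 * n + 5) * ((x : ℝ) - (4 * n + 3) * n))]
    apply iff_of_eq
    congr 1
    · field_simp
    · field_simp
      rw [hD]
      ring
  rw [e1 _ (by positivity), e2]
  norm_cast
end

section
/- Let k be an algebraically closed field of characteristic zero. Let K >= 4 be an even integer, set a = 2K-3, b = 2K-1, m = K^2 - (7/2)K + 2, and let Delta_K be the triangle with vertices (-1/a, 0), (m-K+2, 0), (m, (K-2)b/2). If f ∈ k[x,y] is a nonzero polynomial supported in Delta_K that vanishes to order at least m at e = (1,1), then f is irreducible. -/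
open MvPolynomial

lemma coeff_X_mul_pderiv {σ R : Type*} [CommSemiring R] (i : σ) (f : MvPolynomial σ R)
    (e : σ →₀ ℕ) : coeff e (X i * pderiv i f) = (e i : R) * coeff e f := by
  classical
  induction f using MvPolynomial.induction_on' with
  | monomial u a =>
    rw [X_mul_pderiv_monomial, coeff_smul, coeff_monomial]
    split_ifs with h
    · simp [h]
    · simp
  | add p q hp hq => rw [map_add, mul_add, coeff_add, hp, hq, coeff_add, mul_add]

lemma Derivation.mem_pow_of_mem_pow_succ {R A : Type*} [CommSemiring R] [CommSemiring A]
    [Algebra R A] (D : Derivation R A A) (I : Ideal A) (n : ℕ) {a : A} (ha : a ∈ I ^ (n + 1)) :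
    D a ∈ I ^ n := by
  induction n generalizing a with
  | zero => simp
  | succ n ih =>
    rw [pow_succ] at ha
    refine Submodule.mul_induction_on ha (fun x hx y hy => ?_) (fun x y hx hy => ?_)
    · rw [D.leibniz, smul_eq_mul, smul_eq_mul]
      refine Ideal.add_mem _ (Ideal.mul_mem_right _ _ hx) ?_
      rw [mul_comm, pow_succ]
      exact Ideal.mul_mem_mul (ih hx) hy
    · rw [map_add]
      exact Ideal.add_mem _ hx hy

section

variable {k : Type*} [Field k]

lemma eval_one_eq_zero_of_mem {f : MvPolynomial (Fin 2) k}
    (hf : f ∈ Ideal.span {X 0 - 1, X 1 - 1}) : eval (fun _ => (1 : k)) f = 0 := by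
  have : Ideal.span {X 0 - 1, X 1 - 1} ≤ RingHom.ker (eval (fun _ : Fin 2 => (1 : k))) := by
    rw [Ideal.span_le]
    rintro x (rfl | rfl) <;> simp
  exact this hf

lemma sum_coeff_mul_pow_eq_zero (a b : ℕ) {m : ℕ} (hm : a + b < m) {f : MvPolynomial (Fin 2) k}
    (hf : f ∈ (Ideal.span {X 0 - 1, X 1 - 1} : Ideal (MvPolynomial (Fin 2) k)) ^ m)
    (s : Finset (Fin 2 →₀ ℕ)) (hs : f.support ⊆ s) :
    ∑ e ∈ s, coeff e f * ((e 0 : k) ^ a * (e 1 : k) ^ b) = 0 := by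
  have key (i : Fin 2) {n : ℕ} {g : MvPolynomial (Fin 2) k}
      (hg : g ∈ (Ideal.span {X 0 - 1, X 1 - 1} : Ideal (MvPolynomial (Fin 2) k)) ^ (n + 1)) :
      X i * pderiv i g ∈ (Ideal.span {X 0 - 1, X 1 - 1} : Ideal (MvPolynomial (Fin 2) k)) ^ n :=
    Ideal.mul_mem_left _ _ (Derivation.mem_pow_of_mem_pow_succ _ _ _ hg)
  have ksupp (i : Fin 2) {g : MvPolynomial (Fin 2) k} (hg : g.support ⊆ s) :
      (X i * pderiv i g).support ⊆ s := by
    intro e he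
    rw [mem_support_iff, coeff_X_mul_pderiv] at he
    exact hg (mem_support_iff.2 (right_ne_zero_of_mul he))
  induction a generalizing m f with
  | succ a ih =>
    obtain ⟨m, rfl⟩ : ∃ l, m = l + 1 := ⟨m - 1, by omega⟩
    rw [← ih (by omega) (key 0 hf) (ksupp 0 hs)]
    refine Finset.sum_congr rfl fun e _ => ?_
    rw [coeff_X_mul_pderiv]
    ring
  | zero =>
    induction b generalizing m f with
    | succ b ih =>
      obtain ⟨m, rfl⟩ : ∃ l, m = l + 1 := ⟨m - 1, by omega⟩
      rw [← ih (by omega) (key 1 hf) (ksupp 1 hs)]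
      refine Finset.sum_congr rfl fun e _ => ?_
      rw [coeff_X_mul_pderiv]
      ring
    | zero =>
      have h := eval_one_eq_zero_of_mem (Ideal.pow_le_self (by omega) hf)
      rw [eval_eq] at h
      simp only [one_pow, Finset.prod_const_one, mul_one] at h
      rw [← h]
      simp only [pow_zero, mul_one]
      symm
      exact Finset.sum_subset hs fun e _ he => notMem_support_iff.1 he

lemma sum_coeff_mul_eval_eq_zero {m : ℕ} {f : MvPolynomial (Fin 2) k}
    (hf : f ∈ (Ideal.span {X 0 - 1, X 1 - 1} : Ideal (MvPolynomial (Fin 2) k)) ^ m)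
    (Q : MvPolynomial (Fin 2) k) (hQ : Q.totalDegree < m) :
    ∑ e ∈ f.support, coeff e f * eval (fun i => (e i : k)) Q = 0 := by
  simp only [eval_eq', Finset.mul_sum]
  rw [Finset.sum_comm]
  refine Finset.sum_eq_zero fun d hd => ?_
  have hdeg := le_totalDegree hd
  rw [Finsupp.sum_fintype _ _ (fun _ => rfl), Fin.sum_univ_two] at hdeg
  have := sum_coeff_mul_pow_eq_zero (d 0) (d 1) (by omega) hf _ subset_rfl
  rw [← mul_zero (coeff d Q), ← this, Finset.mul_sum]
  refine Finset.sum_congr rfl fun e _ => ?_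
  rw [Fin.prod_univ_two]
  ring

/-- The maximum over the support of an integral linear form is additive under multiplication. -/
lemma linearForm_add_le_of_mul {g h : MvPolynomial (Fin 2) k} (α β B : ℤ)
    (H : ∀ e ∈ (g * h).support, α * e 0 + β * e 1 ≤ B)
    {a b : Fin 2 →₀ ℕ} (ha : a ∈ g.support) (hb : b ∈ h.support) :
    α * (a 0 + b 0) + β * (a 1 + b 1) ≤ B := by
  classical
  let key : (Fin 2 →₀ ℕ) → ℤ ×ₗ (ℤ ×ₗ ℤ) := fun e =>
    toLex (α * e 0 + β * e 1, toLex ((e 0 : ℤ), (e 1 : ℤ)))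
  have key_add (x y) : key (x + y) = key x + key y := by
    simp only [key, ← toLex_add, Prod.mk_add_mk, Finsupp.add_apply]
    push_cast
    ring_nf
  have key_inj : Function.Injective key := by
    intro x y hxy
    simp only [key, EmbeddingLike.apply_eq_iff_eq, Prod.mk.injEq, Nat.cast_inj] at hxy
    ext i
    fin_cases i
    · exact hxy.2.1
    · exact hxy.2.2
  have key_le {x y} (hxy : key x ≤ key y) : α * x 0 + β * x 1 ≤ α * y 0 + β * y 1 := by
    rcases Prod.Lex.toLex_le_toLex.1 hxy with h | h
    · exact h.le
    · exact h.1.le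
  obtain ⟨a', ha', hamax⟩ := Finset.exists_max_image g.support key ⟨a, ha⟩
  obtain ⟨b', hb', hbmax⟩ := Finset.exists_max_image h.support key ⟨b, hb⟩
  have hmem : a' + b' ∈ (g * h).support := by
    rw [mem_support_iff, coeff_mul, Finset.sum_eq_single (a', b')]
    · exact mul_ne_zero (mem_support_iff.1 ha') (mem_support_iff.1 hb')
    · rintro ⟨x, y⟩ hxy hne
      by_contra hc
      have hx := hamax x (mem_support_iff.2 (left_ne_zero_of_mul hc))
      have hy := hbmax y (mem_support_iff.2 (right_ne_zero_of_mul hc))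
      have hsum : key x + key y = key a' + key b' := by
        rw [← key_add, ← key_add, Finset.HasAntidiagonal.mem_antidiagonal.1 hxy]
      have := (add_eq_add_iff_eq_and_eq hx hy).1 hsum
      exact hne (Prod.ext (key_inj this.1) (key_inj this.2))
    · simp
  have h1 := H _ hmem
  have h2 := key_le (hamax a ha)
  have h3 := key_le (hbmax b hb)
  simp only [Finsupp.add_apply] at h1
  push_cast at h1
  linarith

/-- Translation of `(1, 1)` to the origin. -/
noncomputable def shiftOne : MvPolynomial (Fin 2) k ≃ₐ[k] MvPolynomial (Fin 2) k :=
  AlgEquiv.ofAlgHom (aeval fun i => X i + 1) (aeval fun i => X i - 1)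
    (by ext i; simp) (by ext i; simp)

lemma mem_span_pow_iff_shiftOne (f : MvPolynomial (Fin 2) k) (n : ℕ) :
    f ∈ (Ideal.span {X 0 - 1, X 1 - 1} : Ideal (MvPolynomial (Fin 2) k)) ^ n ↔
      ∀ e ∈ (shiftOne f).support, n ≤ e 0 + e 1 := by
  have h1 : (Ideal.span {X 0 - 1, X 1 - 1} : Ideal (MvPolynomial (Fin 2) k)).map
      (shiftOne (k := k)).toRingEquiv = idealOfVars (Fin 2) k := by
    rw [Ideal.map_span, idealOfVars]
    congr 1
    ext x
    simp [shiftOne, Set.image_pair, eq_comm]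
  have h2 : f ∈ (Ideal.span {X 0 - 1, X 1 - 1} : Ideal (MvPolynomial (Fin 2) k)) ^ n ↔
      shiftOne f ∈ idealOfVars (Fin 2) k ^ n := by
    rw [← h1, ← Ideal.map_pow]
    exact (Ideal.apply_mem_of_equiv_iff (f := (shiftOne (k := k)).toRingEquiv)).symm
  rw [h2, mem_pow_idealOfVars_iff]
  simp [Finsupp.degree_eq_sum, Fin.sum_univ_two]

lemma mem_span_pow_of_mul_mem {g h : MvPolynomial (Fin 2) k} {p q : ℕ}
    (hgh : g * h ∈ (Ideal.span {X 0 - 1, X 1 - 1} : Ideal (MvPolynomial (Fin 2) k)) ^ (p + q))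
    (hh : aeval ![(Polynomial.X : Polynomial k), 1] h ≠ 0) (hq : ∀ e ∈ h.support, e 0 ≤ q) :
    g ∈ (Ideal.span {X 0 - 1, X 1 - 1} : Ideal (MvPolynomial (Fin 2) k)) ^ p := by
  set H : Polynomial k := aeval ![(Polynomial.X : Polynomial k), 1] h with hH
  have hHdeg : H.natDegree ≤ q := by
    rw [hH, aeval_def, eval₂_eq']
    refine Polynomial.natDegree_sum_le_of_forall_le _ _ fun e he => ?_
    simp only [Fin.prod_univ_two, Matrix.cons_val_zero, Matrix.cons_val_one, one_pow, mul_one]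
    exact (Polynomial.natDegree_C_mul_X_pow_le _ _).trans (hq e he)
  have hcomp : aeval ![(Polynomial.X : Polynomial k), 0] (shiftOne h)
      = H.comp (Polynomial.X + 1) := by
    have : (aeval ![(Polynomial.X : Polynomial k), 0]).comp (shiftOne (k := k)).toAlgHom
        = (Polynomial.aeval (Polynomial.X + 1 : Polynomial k)).comp
          (aeval ![(Polynomial.X : Polynomial k), 1]) := by
      ext i : 1
      fin_cases i <;> simp [shiftOne]
    exact DFunLike.congr_fun this h
  have hne : H.comp (Polynomial.X + 1) ≠ 0 := by
    rw [← Polynomial.C_1, ← Polynomial.taylor_apply]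
    simpa using hh
  have hdeg : (H.comp (Polynomial.X + 1)).natDegree ≤ q := by
    rw [← Polynomial.C_1, Polynomial.natDegree_comp, Polynomial.natDegree_X_add_C, mul_one]
    exact hHdeg
  obtain ⟨b, hb, hbq⟩ : ∃ b ∈ (shiftOne h).support, b 0 + b 1 ≤ q := by
    have hlc := mt Polynomial.leadingCoeff_eq_zero.1 hne
    rw [Polynomial.leadingCoeff] at hlc
    set n := (H.comp (Polynomial.X + 1)).natDegree
    rw [← hcomp, aeval_def, eval₂_eq', Polynomial.finsetSum_coeff] at hlc
    obtain ⟨b, hb, hbn⟩ := Finset.exists_ne_zero_of_sum_ne_zero hlc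
    refine ⟨b, hb, ?_⟩
    simp only [Fin.prod_univ_two, Matrix.cons_val_zero, Matrix.cons_val_one] at hbn
    by_cases h1 : b 1 = 0
    · simp only [h1, pow_zero, mul_one, Polynomial.algebraMap_eq, Polynomial.coeff_C_mul,
        Polynomial.coeff_X_pow] at hbn
      by_cases h0 : n = b 0
      · omega
      · simp [h0] at hbn
    · simp [h1] at hbn
  rw [mem_span_pow_iff_shiftOne] at hgh ⊢
  rw [map_mul] at hgh
  intro a ha
  have := linearForm_add_le_of_mul (-1) (-1) (-((p : ℤ) + q)) (fun e he => by
    have := hgh e he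
    omega) ha hb
  omega

end

section
variable {k : Type*} [Field k]

lemma mul_prod_range_sub_one {R : Type*} [CommRing R] (z : R) (i : ℕ) :
    z * ∏ l ∈ Finset.range i, (z - 1 - l) = (∏ l ∈ Finset.range i, (z - l)) * (z - i) := by
  rw [← Finset.prod_range_succ, Finset.prod_range_succ']
  push_cast
  rw [sub_zero, mul_comm]
  congr 1
  refine Finset.prod_congr rfl fun l _ => ?_
  ring

/-- A polynomial of degree at most `d` in one variable extends from the line `T = t₀` to a
polynomial of total degree at most `d` vanishing on the simplex `S + T < d` of natural points, and
the extension is explicit on the line `T = t₀ - 1`. -/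
lemma exists_simplex_extension {σ : Type*} (S T : MvPolynomial σ k) (hS : S.totalDegree ≤ 1)
    (hT : T.totalDegree ≤ 1) (d : ℕ) (t₀ : k) (ht₀ : ∀ j : ℕ, j < d → t₀ ≠ j)
    (P : Polynomial k) (hP : P.natDegree ≤ d) :
    ∃ Q : MvPolynomial σ k, Q.totalDegree ≤ d ∧
      (∀ v, ∀ s t : ℕ, eval v S = s → eval v T = t → s + t < d → eval v Q = 0) ∧
      (∀ v, eval v T = t₀ → eval v Q = P.eval (eval v S)) ∧
      ∀ v, eval v T = t₀ - 1 → t₀ * eval v Q =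
        (t₀ - d + eval v S) * P.eval (eval v S) - eval v S * P.eval (eval v S - 1) := by
  suffices H : ∀ i ≤ d, ∀ P : Polynomial k, P.natDegree ≤ i →
    ∃ Q : MvPolynomial σ k, Q.totalDegree ≤ d ∧
      (∀ v, ∀ s t : ℕ, eval v S = s → eval v T = t → s + t < d → eval v Q = 0) ∧
      (∀ v, eval v T = t₀ → eval v Q = P.eval (eval v S)) ∧
      ∀ v, eval v T = t₀ - 1 → t₀ * eval v Q =
        (t₀ - d + eval v S) * P.eval (eval v S) - eval v S * P.eval (eval v S - 1) from
    H d le_rfl P hP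
  have basis (i : ℕ) (hi : i ≤ d) (c : k) : ∃ Q : MvPolynomial σ k, Q.totalDegree ≤ d ∧
      (∀ v, ∀ s t : ℕ, eval v S = s → eval v T = t → s + t < d → eval v Q = 0) ∧
      (∀ v, eval v T = t₀ → eval v Q = c * ∏ l ∈ Finset.range i, (eval v S - l)) ∧
      ∀ v, eval v T = t₀ - 1 → t₀ * eval v Q =
        (t₀ - d + eval v S) * (c * ∏ l ∈ Finset.range i, (eval v S - l)) -
          eval v S * (c * ∏ l ∈ Finset.range i, (eval v S - 1 - l)) := by
    have hne : ∏ l ∈ Finset.range (d - i), (t₀ - (l : k)) ≠ 0 :=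
      Finset.prod_ne_zero_iff.2 fun l hl => sub_ne_zero.2 (ht₀ l (by
        have := Finset.mem_range.1 hl
        omega))
    have hdeg (U : MvPolynomial σ k) (hU : U.totalDegree ≤ 1) (n : ℕ) :
        (∏ l ∈ Finset.range n, (U - C (l : k))).totalDegree ≤ n := by
      refine (totalDegree_finsetProd _ _).trans ?_
      refine (Finset.sum_le_card_nsmul _ _ 1 fun l _ =>
        (totalDegree_sub_C_le _ _).trans hU).trans ?_
      simp
    refine ⟨C (c / ∏ l ∈ Finset.range (d - i), (t₀ - (l : k))) *
      ((∏ l ∈ Finset.range i, (S - C (l : k))) * ∏ l ∈ Finset.range (d - i), (T - C (l : k))),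
      ?_, ?_, ?_, ?_⟩
    · refine (totalDegree_mul _ _).trans ?_
      have h1 := totalDegree_mul (∏ l ∈ Finset.range i, (S - C (l : k)))
        (∏ l ∈ Finset.range (d - i), (T - C (l : k)))
      have h2 := hdeg S hS i
      have h3 := hdeg T hT (d - i)
      rw [totalDegree_C]
      omega
    · intro v s t hs ht hst
      simp only [map_mul, map_prod, map_sub, eval_C, hs, ht]
      generalize c / _ = c'
      by_cases h : s < i
      · rw [Finset.prod_eq_zero (i := s) (Finset.mem_range.2 h) (sub_self _)]
        simp
      · rw [Finset.prod_eq_zero (s := Finset.range (d - i)) (i := t)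
          (f := fun l : ℕ => (t : k) - l)
          (Finset.mem_range.2 (by omega)) (sub_self _)]
        simp
    · intro v hv
      simp only [map_mul, map_prod, map_sub, eval_C, hv]
      field_simp
    · intro v hv
      simp only [map_mul, map_prod, map_sub, eval_C, hv]
      have h1 := mul_prod_range_sub_one t₀ (d - i)
      have h2 := mul_prod_range_sub_one (eval v S) i
      rw [Nat.cast_sub hi] at h1
      generalize ∏ l ∈ Finset.range (d - i), (t₀ - (l : k)) = A at *
      generalize ∏ l ∈ Finset.range (d - i), (t₀ - 1 - (l : k)) = B at *
      generalize ∏ l ∈ Finset.range i, (eval v S - (l : k)) = U at *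
      generalize ∏ l ∈ Finset.range i, (eval v S - 1 - (l : k)) = V at *
      have : t₀ * (c / A * (U * B)) = c / A * U * (A * (t₀ - (d - i))) := by
        rw [← h1]; ring
      rw [this]
      have : c / A * U * (A * (t₀ - (d - i))) = c * U * (t₀ - (d - i)) := by
        field_simp
      rw [this]
      linear_combination c * h2
  intro i
  induction i with
  | zero =>
    intro hi P hP
    obtain ⟨Q, h1, h2, h3, h4⟩ := basis 0 hi (P.coeff 0)
    rw [Polynomial.eq_C_of_natDegree_le_zero hP]
    exact ⟨Q, h1, h2, by simpa using h3, by simpa using h4⟩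
  | succ i ih =>
    intro hi P hP
    set F : Polynomial k := ∏ l ∈ Finset.range (i + 1), (Polynomial.X - Polynomial.C (l : k))
      with hF
    have hFm : F.Monic := Polynomial.monic_prod_X_sub_C _ _
    have hFd : F.natDegree = i + 1 := by
      rw [hF, Polynomial.natDegree_prod_of_monic _ _ fun l _ => Polynomial.monic_X_sub_C _]
      simp only [Polynomial.natDegree_X_sub_C, Finset.sum_const, Finset.card_range, smul_eq_mul,
        mul_one]
    have hlow : (P - Polynomial.C (P.coeff (i + 1)) * F).natDegree ≤ i := by
      rw [Polynomial.natDegree_le_iff_coeff_eq_zero]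
      intro N hN
      rw [Polynomial.coeff_sub, Polynomial.coeff_C_mul]
      rcases (Nat.succ_le_of_lt hN).eq_or_lt with h | h
      · have : F.coeff N = 1 := by
          rw [← h, Nat.succ_eq_add_one, ← hFd]
          exact hFm
        rw [this, ← h]
        simp
      · rw [Polynomial.coeff_eq_zero_of_natDegree_lt (hP.trans_lt h),
          Polynomial.coeff_eq_zero_of_natDegree_lt (p := F) (by omega)]
        simp
    obtain ⟨Q, h1, h2, h3, h4⟩ := ih (by omega) _ hlow
    obtain ⟨Q', h1', h2', h3', h4'⟩ := basis (i + 1) hi (P.coeff (i + 1))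
    have hFe (z : k) : F.eval z = ∏ l ∈ Finset.range (i + 1), (z - (l : k)) := by
      simp [hF, Polynomial.eval_prod]
    refine ⟨Q + Q', (totalDegree_add _ _).trans (max_le h1 h1'), ?_, ?_, ?_⟩
    · intro v s t hs ht hst
      rw [map_add, h2 v s t hs ht hst, h2' v s t hs ht hst, add_zero]
    · intro v hv
      rw [map_add, h3 v hv, h3' v hv, Polynomial.eval_sub, Polynomial.eval_mul, Polynomial.eval_C,
        hFe]
      ring
    · intro v hv
      rw [map_add, mul_add, h4 v hv, h4' v hv]
      simp only [Polynomial.eval_sub, Polynomial.eval_mul, Polynomial.eval_C, hFe]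
      ring
end

section
variable {k : Type*} [Field k] [CharZero k]

/-- No polynomial whose Newton polygon touches the vertex `(p, u) = n (4 L + 3, 4 L + 5)` of the
triangle with left edge through the origin and right edge of slope `(4L + 7) / 2` vanishes to order
`p` at `(1, 1)`. -/
lemma coeff_vertex_eq_zero (L n : ℕ) (hn : 1 ≤ n) (hnL : n ≤ L + 1) (g : MvPolynomial (Fin 2) k)
    (hg : g ∈ (Ideal.span {X 0 - 1, X 1 - 1} : Ideal (MvPolynomial (Fin 2) k)) ^ (n * (4 * L + 3)))
    (hx : ∀ e ∈ g.support, e 0 ≤ n * (4 * L + 3))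
    (hl : ∀ e ∈ g.support, (4 * L + 3) * e 1 ≤ (4 * L + 5) * e 0)
    (hr : ∀ e ∈ g.support, (4 * L + 7) * (e 0 : ℤ) - 2 * e 1 ≤
      (4 * L + 7) * (n * (4 * L + 3)) - 2 * (n * (4 * L + 5)))
    (v : Fin 2 →₀ ℕ) (hv0 : v 0 = n * (4 * L + 3)) (hv1 : v 1 = n * (4 * L + 5)) :
    coeff v g = 0 := by
  obtain ⟨p, hp⟩ : ∃ p, p = n * (4 * L + 3) := ⟨_, rfl⟩
  obtain ⟨u, hu⟩ : ∃ u, u = n * (4 * L + 5) := ⟨_, rfl⟩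
  have hpu : u = p + 2 * n := by rw [hp, hu]; ring
  have hpL : 4 * L + 3 ≤ p := by rw [hp]; exact Nat.le_mul_of_pos_left _ hn
  rw [← hp] at hg hv0
  rw [← hu] at hv1
  simp only [← hp] at hx
  let D : Finset ℕ := (Finset.range (2 * L + 2)).erase (2 * n - 1)
  have hDcard : D.card = 2 * L + 1 := by
    rw [Finset.card_erase_of_mem (Finset.mem_range.2 (by omega)), Finset.card_range]
    omega
  let P : Polynomial k := ∏ l ∈ D, (Polynomial.X - Polynomial.C ((l : k) - 2 * n))
  have hPdeg : P.natDegree ≤ 2 * L + 1 := by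
    simp only [P]
    rw [Polynomial.natDegree_prod_of_monic _ _ fun l _ => Polynomial.monic_X_sub_C _]
    simp only [Polynomial.natDegree_X_sub_C, Finset.sum_const, smul_eq_mul, mul_one, hDcard, le_rfl]
  have hPe (z : k) : P.eval z = ∏ l ∈ D, (z - ((l : k) - 2 * n)) := by
    simp [P, Polynomial.eval_prod]
  have hone : (1 : MvPolynomial (Fin 2) k) = C 1 := C_1.symm
  obtain ⟨Q, hQdeg, hQ0, hQ1, hQ2⟩ := exists_simplex_extension
    (X 0 - X 1 - 1 : MvPolynomial (Fin 2) k) (C ((2 * L + 1 : ℕ) : k) - X 0)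
    (by
      rw [hone]
      refine (totalDegree_sub_C_le _ _).trans ((totalDegree_sub _ _).trans ?_)
      simp)
    ((totalDegree_sub _ _).trans
      (max_le (by rw [totalDegree_C]; omega) (by rw [totalDegree_X])))
    (2 * L + 1) ((2 * L + 2 : ℕ) - (p : k)) (by
      intro j _ h
      rw [sub_eq_iff_eq_add, ← Nat.cast_add, Nat.cast_inj] at h
      omega) P hPdeg
  simp only [map_sub, eval_X, eval_C, map_one] at hQ0 hQ1 hQ2
  let R : MvPolynomial (Fin 2) k := (X 1 - X 0) *
    ((∏ c ∈ Finset.Ico (2 * L + 2) (p - 1), (X 0 - C (c : k))) * Q)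
  have hR (w : Fin 2 → k) : eval w R = (w 1 - w 0) *
      ((∏ c ∈ Finset.Ico (2 * L + 2) (p - 1), (w 0 - (c : k))) * eval w Q) := by
    simp [R]
  have hRdeg : R.totalDegree < p := by
    have h1 : (X 1 - X 0 : MvPolynomial (Fin 2) k).totalDegree ≤ 1 :=
      (totalDegree_sub _ _).trans (by simp)
    have h2 : (∏ c ∈ Finset.Ico (2 * L + 2) (p - 1),
        (X 0 - C (c : k) : MvPolynomial (Fin 2) k)).totalDegree ≤ p - 1 - (2 * L + 2) := by
      refine (totalDegree_finsetProd _ _).trans ?_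
      refine (Finset.sum_le_card_nsmul _ _ 1 fun l _ =>
        (totalDegree_sub_C_le _ _).trans (by simp)).trans ?_
      simp
    have h3 := totalDegree_mul (∏ c ∈ Finset.Ico (2 * L + 2) (p - 1),
        (X 0 - C (c : k) : MvPolynomial (Fin 2) k)) Q
    have h4 := totalDegree_mul (X 1 - X 0 : MvPolynomial (Fin 2) k)
      ((∏ c ∈ Finset.Ico (2 * L + 2) (p - 1), (X 0 - C (c : k))) * Q)
    simp only [R]
    omega
  have hsum := sum_coeff_mul_eval_eq_zero hg R hRdeg
  by_contra hv
  have hvsupp : v ∈ g.support := mem_support_iff.2 hv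
  rw [Finset.sum_eq_single v _ (fun h => absurd hvsupp h)] at hsum
  · have hev := (mul_eq_zero.1 hsum).resolve_left hv
    rw [hR, hv0, hv1] at hev
    have hnk : (n : k) ≠ 0 := Nat.cast_ne_zero.2 (by omega)
    have hpk : (p : k) = n * (4 * L + 3) := by rw [hp]; push_cast; ring
    have huk : (u : k) = p + 2 * n := by rw [hpu]; push_cast; ring
    have hQv : eval (fun i => (v i : k)) Q = 0 := by
      rcases mul_eq_zero.1 hev with h | h
      · rw [huk] at h
        simp [hnk] at h
      · refine (mul_eq_zero.1 h).resolve_left (Finset.prod_ne_zero_iff.2 fun c hc => ?_)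
        rw [sub_ne_zero, Ne, Nat.cast_inj]
        have := Finset.mem_Ico.1 hc
        omega
    have h2 := hQ2 (fun i => (v i : k)) (by simp only [hv0]; push_cast; ring)
    rw [hQv, mul_zero] at h2
    simp only [hv0, hv1] at h2
    have hmem : 2 * n - 1 ∈ Finset.range (2 * L + 2) := Finset.mem_range.2 (by omega)
    have hcast : ((2 * n - 1 : ℕ) : k) = 2 * n - 1 := by
      rw [Nat.cast_sub (by omega)]
      push_cast
      ring
    have e1 := Finset.mul_prod_erase (Finset.range (2 * L + 2)) (fun l : ℕ => -((l : k) + 1)) hmem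
    have e2 := Finset.mul_prod_erase (Finset.range (2 * L + 2)) (fun l : ℕ => -((l : k) + 2)) hmem
    have p1 : P.eval ((p : k) - u - 1) = ∏ l ∈ D, -((l : k) + 1) := by
      rw [hPe, huk]
      exact Finset.prod_congr rfl fun l _ => by ring
    have p2 : P.eval ((p : k) - u - 1 - 1) = ∏ l ∈ D, -((l : k) + 2) := by
      rw [hPe, huk]
      exact Finset.prod_congr rfl fun l _ => by ring
    have e3 : ∏ l ∈ Finset.range (2 * L + 2), -((l : k) + 2) =
        (2 * L + 3) * ∏ l ∈ Finset.range (2 * L + 2), -((l : k) + 1) := by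
      have h := Finset.prod_range_succ (fun l : ℕ => -((l : k) + 1)) (2 * L + 2)
      rw [Finset.prod_range_succ'] at h
      push_cast at h
      have : ∏ l ∈ Finset.range (2 * L + 2), -((l : k) + 2) =
          ∏ l ∈ Finset.range (2 * L + 2), -((l : k) + 1 + 1) :=
        Finset.prod_congr rfl fun l _ => by ring
      rw [this]
      linear_combination -h
    have hW : ∏ l ∈ Finset.range (2 * L + 2), -((l : k) + 1) ≠ 0 :=
      Finset.prod_ne_zero_iff.2 fun l _ => neg_ne_zero.2 (Nat.cast_add_one_ne_zero l)
    rw [p1, p2, huk] at h2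
    rw [e3, hcast] at e2
    rw [hcast] at e1
    change _ * ∏ l ∈ D, _ = _ at e1
    change _ * ∏ l ∈ D, _ = _ at e2
    generalize ∏ l ∈ Finset.range (2 * L + 2), -((l : k) + 1) = W at *
    generalize ∏ l ∈ D, -((l : k) + 1) = A at *
    generalize ∏ l ∈ D, -((l : k) + 2) = B at *
    apply hW
    push_cast at h2
    rw [hpk] at h2
    linear_combination 2 * h2 + (4 * L + 5) * e1 - 2 * e2
  · intro e he hne
    have h1 := hx e he
    have h2 := hl e he
    have h3 := hr e he
    rw [mul_eq_zero, hR, mul_eq_zero, mul_eq_zero]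
    right
    by_cases hd : e 1 = e 0
    · left
      rw [hd, sub_self]
    right
    by_cases hmid : 2 * L + 2 ≤ e 0 ∧ e 0 < p - 1
    · left
      exact Finset.prod_eq_zero (Finset.mem_Ico.2 hmid) (sub_self _)
    right
    by_cases hsmall : e 0 ≤ 2 * L + 1
    · have hlt : e 1 < e 0 := by
        refine lt_of_le_of_ne ?_ hd
        by_contra hc
        nlinarith
      refine hQ0 _ (e 0 - e 1 - 1) (2 * L + 1 - e 0) ?_ ?_ (by omega)
      · rw [Nat.sub_sub, Nat.cast_sub (by omega)]
        push_cast
        ring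
      · rw [Nat.cast_sub hsmall]
    have hz1 : (p : ℤ) = n * (4 * L + 3) := by exact_mod_cast hp
    have hz2 : (u : ℤ) = n * (4 * L + 5) := by exact_mod_cast hu
    rw [← hz1, ← hz2] at h3
    have h2z : (4 * L + 3) * (e 1 : ℤ) ≤ (4 * L + 5) * e 0 := by exact_mod_cast h2
    have hrel : (4 * L + 5) * (p : ℤ) = (4 * L + 3) * u := by rw [hz1, hz2]; ring
    rcases (show e 0 = p - 1 ∨ e 0 = p by omega) with h0 | h0
    · rw [hQ1 _ (by simp only [h0]; rw [Nat.cast_sub (by omega)]; push_cast; ring), hPe]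
      have h0z : (e 0 : ℤ) = p - 1 := by omega
      rw [h0z] at h2z h3
      have hy1 : (e 1 : ℤ) ≤ u - 2 := by
        by_contra hc
        nlinarith
      have hy2 : (u : ℤ) ≤ e 1 + 2 * L + 3 := by linarith
      have hlk : ((u - 2 - e 1 : ℕ) : k) = (e 0 : k) - e 1 - 1 + 2 * n := by
        rw [h0, Nat.sub_sub, Nat.cast_sub (by omega), Nat.cast_sub (by omega), hpu]
        push_cast
        ring
      refine Finset.prod_eq_zero (i := u - 2 - e 1) ?_ ?_
      · rw [Finset.mem_erase, Finset.mem_range]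
        omega
      · rw [hlk]
        ring
    · exfalso
      apply hne
      have h0z : (e 0 : ℤ) = p := by omega
      rw [h0z] at h2z h3
      have hy1 : (e 1 : ℤ) ≤ u := by
        by_contra hc
        nlinarith
      ext i
      fin_cases i
      · exact h0.trans hv0.symm
      · change e 1 = v 1
        rw [hv1]
        omega

end

section
variable {k : Type*} [Field k]

/-- The lattice points of the triangle `Delta_K` for `K = 2 L + 4`. -/
def InTriangle (L x y : ℕ) : Prop :=
  (4 * L + 3) * y ≤ (4 * L + 5) * x + 1 ∧
    (4 * L + 7) * x ≤ 2 * y + (4 * L + 7) * (4 * L ^ 2 + 7 * L + 2) ∧ x ≤ 4 * L ^ 2 + 9 * L + 4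

lemma InTriangle.exists_column_bound (L s x j : ℕ) (hj₁ : (4 * L + 5) * j ≤ 2 * s + 1)
    (hj₂ : 2 * s + 1 < (4 * L + 5) * (j + 1)) (hs : 1 ≤ s)
    (hx : x + j + 1 ≤ s ∨ 4 * L ^ 2 + 9 * L + 4 ≤ x + j) :
    ∃ lo : ℕ, ∀ y, InTriangle L x y → lo ≤ y ∧ y < lo + s := by
  rcases hx with hx | hx
  · refine ⟨0, fun y hy => ⟨Nat.zero_le _, ?_⟩⟩
    by_contra hc
    have h1 : (4 * L + 5) * (x + j + 1) ≤ (4 * L + 5) * s := Nat.mul_le_mul_left _ hx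
    have h2 : (4 * L + 3) * s ≤ (4 * L + 3) * y := Nat.mul_le_mul_left _ (by omega)
    nlinarith [hy.1]
  · obtain ⟨m, hm⟩ : ∃ m, m = 4 * L ^ 2 + 9 * L + 4 := ⟨_, rfl⟩
    obtain ⟨t, ht⟩ : ∃ t, t = (L + 1) * (4 * L + 7) := ⟨_, rfl⟩
    refine ⟨if x = m then t else t - (m - x) - s, fun y hy => ?_⟩
    obtain ⟨h1, h2, h3⟩ := hy
    rw [← hm] at hx h3
    obtain ⟨i, rfl⟩ := Nat.exists_eq_add_of_le h3
    have hij : i ≤ j := by omega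
    have hi : (4 * L + 5) * i ≤ (4 * L + 5) * j := Nat.mul_le_mul_left _ hij
    have g1 : (4 * L + 3) * y + (4 * L + 5) * i ≤ (4 * L + 3) * t := by
      rw [ht]
      nlinarith
    have g2 : 2 * t ≤ 2 * y + (4 * L + 7) * i := by
      rw [ht]
      nlinarith
    rcases Nat.eq_zero_or_pos i with rfl | hpos
    · have : y ≤ t := by
        by_contra hc
        have : (4 * L + 3) * (t + 1) ≤ (4 * L + 3) * y := Nat.mul_le_mul_left _ (by omega)
        nlinarith
      simp
      omega
    · have h4 : y + i + 1 ≤ t := by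
        by_contra hc
        have : (4 * L + 3) * t ≤ (4 * L + 3) * (y + i) := Nat.mul_le_mul_left _ (by omega)
        nlinarith
      have h5 : 2 * t ≤ 2 * y + 2 * i + 2 * s + 1 := by nlinarith
      rw [if_neg (by omega)]
      omega

/-- The value on `Q(y)` of the restriction of `f` to the column `x = i`, seen as a distribution. -/
noncomputable def columnSum (f : MvPolynomial (Fin 2) k) (i : ℕ) (Q : Polynomial k) : k :=
  ∑ e ∈ f.support with e 0 = i, coeff e f * Q.eval (e 1 : k)

lemma totalDegree_aeval_X_le {σ : Type*} (i : σ) (Q : Polynomial k) :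
    (Polynomial.aeval (X i : MvPolynomial σ k) Q).totalDegree ≤ Q.natDegree := by
  rw [Polynomial.aeval_eq_sum_range]
  refine totalDegree_finsetSum_le fun j hj => ?_
  refine (totalDegree_smul_le _ _).trans ?_
  rw [totalDegree_X_pow]
  exact Nat.lt_succ_iff.1 (Finset.mem_range.1 hj)

lemma columnSum_eq_zero_of_forall [CharZero k] {m : ℕ} {f : MvPolynomial (Fin 2) k}
    (hf : f ∈ (Ideal.span {X 0 - 1, X 1 - 1} : Ideal (MvPolynomial (Fin 2) k)) ^ m)
    (R : Finset ℕ) (i : ℕ) (hi : i ∉ R) (Q : Polynomial k) (hdeg : R.card + Q.natDegree < m)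
    (h : ∀ c ∉ R, c ≠ i → columnSum f c Q = 0) : columnSum f i Q = 0 := by
  have hsum := sum_coeff_mul_eval_eq_zero hf
    ((∏ c ∈ R, (X 0 - C (c : k))) * Polynomial.aeval (X 1) Q) (by
      refine (totalDegree_mul _ _).trans_lt (lt_of_le_of_lt ?_ hdeg)
      refine add_le_add ((totalDegree_finsetProd _ _).trans ?_) (totalDegree_aeval_X_le _ _)
      refine (Finset.sum_le_card_nsmul _ _ 1 fun l _ =>
        (totalDegree_sub_C_le _ _).trans (by simp)).trans ?_
      simp)
  have heval (w : Fin 2 → k) : eval w (Polynomial.aeval (X 1) Q) = Q.eval (w 1) := by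
    have := Polynomial.aeval_algHom_apply (aeval w : MvPolynomial (Fin 2) k →ₐ[k] k) (X 1) Q
    simpa [← Polynomial.coe_aeval_eq_eval, aeval_eq_eval] using this.symm
  simp only [map_mul, map_prod, map_sub, eval_X, eval_C, heval] at hsum
  rw [← Finset.sum_fiberwise_of_maps_to (g := fun e : Fin 2 →₀ ℕ => e 0)
    (t := insert i (f.support.image fun e => e 0))
    (fun e he => Finset.mem_insert_of_mem (Finset.mem_image_of_mem _ he))] at hsum
  have hcol (c : ℕ) : ∑ e ∈ f.support with e 0 = c,
      coeff e f * ((∏ l ∈ R, ((e 0 : k) - l)) * Q.eval (e 1 : k)) =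
        (∏ l ∈ R, ((c : k) - l)) * columnSum f c Q := by
    rw [columnSum, Finset.mul_sum]
    refine Finset.sum_congr rfl fun e he => ?_
    rw [(Finset.mem_filter.1 he).2]
    ring
  simp only [hcol] at hsum
  rw [Finset.sum_eq_single i _ (fun h => absurd (Finset.mem_insert_self _ _) h)] at hsum
  · refine (mul_eq_zero.1 hsum).resolve_left (Finset.prod_ne_zero_iff.2 fun l hl => ?_)
    rw [sub_ne_zero, Ne, Nat.cast_inj]
    rintro rfl
    exact hi hl
  · intro c _ hc
    by_cases hR : c ∈ R
    · rw [Finset.prod_eq_zero hR (sub_self _), zero_mul]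
    · rw [h c hR hc, mul_zero]

lemma coeff_eq_zero_of_columnSum_eq_zero [CharZero k] {f : MvPolynomial (Fin 2) k} {s : ℕ}
    (i lo : ℕ) (hlo : ∀ e ∈ f.support, e 0 = i → lo ≤ e 1 ∧ e 1 < lo + s)
    (h : ∀ Q : Polynomial k, Q.natDegree < s → columnSum f i Q = 0) (e : Fin 2 →₀ ℕ)
    (he : e 0 = i) : coeff e f = 0 := by
  by_contra hc
  have hes : e ∈ f.support := mem_support_iff.2 hc
  have hmem : e 1 ∈ Finset.Ico lo (lo + s) := Finset.mem_Ico.2 (hlo e hes he)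
  have h0 := h (∏ y ∈ (Finset.Ico lo (lo + s)).erase (e 1),
    (Polynomial.X - Polynomial.C (y : k))) (by
      rw [Polynomial.natDegree_prod_of_monic _ _ fun l _ => Polynomial.monic_X_sub_C _]
      simp only [Polynomial.natDegree_X_sub_C, Finset.sum_const, smul_eq_mul, mul_one,
        Finset.card_erase_of_mem hmem, Nat.card_Ico]
      have := Finset.mem_Ico.1 hmem
      omega)
  simp only [columnSum, Polynomial.eval_prod, Polynomial.eval_sub, Polynomial.eval_X,
    Polynomial.eval_C] at h0
  rw [Finset.sum_eq_single e] at h0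
  · refine (Finset.prod_ne_zero_iff.2 fun l hl => ?_) ((mul_eq_zero.1 h0).resolve_left hc)
    rw [sub_ne_zero, Ne, Nat.cast_inj]
    rintro rfl
    exact Finset.notMem_erase _ _ hl
  · intro e' he' hne
    obtain ⟨h1, h2⟩ := Finset.mem_filter.1 he'
    refine mul_eq_zero_of_right _ (Finset.prod_eq_zero (i := e' 1) ?_ (sub_self _))
    refine Finset.mem_erase.2 ⟨fun h3 => hne ?_, Finset.mem_Ico.2 (hlo e' h1 h2)⟩
    ext l
    fin_cases l
    · exact h2.trans he.symm
    · exact h3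
  · exact fun hn => absurd (Finset.mem_filter.2 ⟨hes, he⟩) hn

/-- No column of a nonzero polynomial supported in the triangle and vanishing to order `m` at
`(1, 1)` has vanishing coefficient sum. -/
lemma columnSum_one_ne_zero [CharZero k] (L : ℕ) {f : MvPolynomial (Fin 2) k} (hf0 : f ≠ 0)
    (hf : f ∈ (Ideal.span {X 0 - 1, X 1 - 1} : Ideal (MvPolynomial (Fin 2) k)) ^
      (4 * L ^ 2 + 9 * L + 4))
    (hsupp : ∀ e ∈ f.support, InTriangle L (e 0) (e 1)) (i₀ : ℕ)
    (hi₀ : i₀ ≤ 4 * L ^ 2 + 9 * L + 4) :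
    columnSum f i₀ 1 ≠ 0 := by
  intro hi₀0
  obtain ⟨m, hm⟩ : ∃ m, m = 4 * L ^ 2 + 9 * L + 4 := ⟨_, rfl⟩
  rw [← hm] at hf hi₀
  have hbig (i : ℕ) (hi : m < i) (Q : Polynomial k) : columnSum f i Q = 0 := by
    refine Finset.sum_eq_zero fun e he => ?_
    obtain ⟨h1, h2⟩ := Finset.mem_filter.1 he
    have := (hsupp e h1).2.2
    omega
  have hshort (s i : ℕ) (hs : 1 ≤ s) (h : ∀ Q : Polynomial k, Q.natDegree < s → columnSum f i Q = 0)
      (hi : i + (2 * s + 1) / (4 * L + 5) + 1 ≤ s ∨ m ≤ i + (2 * s + 1) / (4 * L + 5))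
      (e : Fin 2 →₀ ℕ) (he : e 0 = i) : coeff e f = 0 := by
    obtain ⟨lo, hlo⟩ := InTriangle.exists_column_bound L s i _ (Nat.mul_div_le _ _)
      (Nat.lt_mul_div_succ _ (by omega)) hs (hm ▸ hi)
    exact coeff_eq_zero_of_columnSum_eq_zero i lo
      (fun e he hei => hlo _ (hei ▸ hsupp e he)) h e he
  have main (s : ℕ) (hs : 1 ≤ s) (hsm : s ≤ m) :
      ∀ i, ∀ Q : Polynomial k, Q.natDegree < s → columnSum f i Q = 0 := by
    induction s, hs using Nat.le_induction with
    | base =>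
      intro i Q hQ
      rw [Polynomial.eq_C_of_natDegree_eq_zero (by omega : Q.natDegree = 0)]
      generalize Q.coeff 0 = c
      have hC (i : ℕ) : columnSum f i (Polynomial.C c) = c * columnSum f i 1 := by
        simp only [columnSum, Finset.mul_sum, Polynomial.eval_C, Polynomial.eval_one]
        exact Finset.sum_congr rfl fun e _ => by ring
      rcases eq_or_ne i i₀ with rfl | hne
      · rw [hC, hi₀0, mul_zero]
      rcases lt_or_ge m i with hi | hi
      · exact hbig i hi _
      refine columnSum_eq_zero_of_forall hf (((Finset.range (m + 1)).erase i₀).erase i) i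
        (Finset.notMem_erase _ _) _ ?_ fun c hc hci => ?_
      · rw [Finset.card_erase_of_mem, Finset.card_erase_of_mem, Finset.card_range,
          Polynomial.natDegree_C]
        · omega
        · exact Finset.mem_range.2 (by omega)
        · exact Finset.mem_erase.2 ⟨hne, Finset.mem_range.2 (by omega)⟩
      · rcases eq_or_ne c i₀ with rfl | hne'
        · rw [hC, hi₀0, mul_zero]
        · refine hbig c ?_ _
          simp only [Finset.mem_erase, Finset.mem_range, not_and, not_lt] at hc
          exact hc hci hne'
    | succ s hs ih =>
      have ih := ih (by omega)
      intro i Q hQ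
      have hz (i : ℕ) (hi : i + (2 * s + 1) / (4 * L + 5) + 1 ≤ s ∨
          m ≤ i + (2 * s + 1) / (4 * L + 5)) : columnSum f i Q = 0 := by
        refine Finset.sum_eq_zero fun e he => ?_
        rw [hshort s i hs (ih i) hi e (Finset.mem_filter.1 he).2, zero_mul]
      by_cases hi : i + (2 * s + 1) / (4 * L + 5) + 1 ≤ s ∨ m ≤ i + (2 * s + 1) / (4 * L + 5)
      · exact hz i hi
      have hjs : (2 * s + 1) / (4 * L + 5) ≤ s := by
        refine Nat.div_le_of_le_mul ?_
        nlinarith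
      refine columnSum_eq_zero_of_forall hf ((Finset.Ico (s - (2 * s + 1) / (4 * L + 5))
        (m - (2 * s + 1) / (4 * L + 5))).erase i) i (Finset.notMem_erase _ _) _ ?_
        fun c hc hci => hz c ?_
      · rw [Finset.card_erase_of_mem (Finset.mem_Ico.2 (by omega)), Nat.card_Ico]
        omega
      · simp only [Finset.mem_erase, Finset.mem_Ico, not_and, not_lt] at hc
        have := hc hci
        omega
  apply hf0
  ext e
  rw [coeff_zero]
  refine hshort m (e 0) (by omega) (main m (by omega) le_rfl _) ?_ e rfl
  omega

end

section
variable {k : Type*} [Field k] [CharZero k]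

/-- In a factorization `f = g * h`, the factor whose top vertex lies on the line through the origin
parallel to the left edge is a unit. -/
lemma isUnit_of_vertex_on_line (L : ℕ) {g h : MvPolynomial (Fin 2) k}
    (hf : g * h ∈ (Ideal.span {X 0 - 1, X 1 - 1} : Ideal (MvPolynomial (Fin 2) k)) ^
      (4 * L ^ 2 + 9 * L + 4))
    (hsupp : ∀ e ∈ (g * h).support, InTriangle L (e 0) (e 1))
    (hh : aeval ![(Polynomial.X : Polynomial k), 1] h ≠ 0)
    (hg0 : 0 ∈ g.support) {v w : Fin 2 →₀ ℕ}
    (hv : v ∈ g.support) (hw : w ∈ h.support) (hvw0 : v 0 + w 0 = 4 * L ^ 2 + 9 * L + 4)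
    (hvw1 : v 1 + w 1 = (L + 1) * (4 * L + 7)) (hline : (4 * L + 3) * v 1 = (4 * L + 5) * v 0) :
    IsUnit g := by
  have hL {a b : Fin 2 →₀ ℕ} (ha : a ∈ g.support) (hb : b ∈ h.support) :
      -(4 * L + 5) * (a 0 + b 0 : ℤ) + (4 * L + 3) * (a 1 + b 1) ≤ 1 :=
    linearForm_add_le_of_mul _ _ 1 (fun e he => by
      have := (hsupp e he).1
      zify at this
      linarith) ha hb
  have hR {a b : Fin 2 →₀ ℕ} (ha : a ∈ g.support) (hb : b ∈ h.support) :
      (4 * L + 7) * (a 0 + b 0 : ℤ) + -2 * (a 1 + b 1) ≤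
        (4 * L + 7) * (4 * L ^ 2 + 7 * L + 2) :=
    linearForm_add_le_of_mul _ _ _ (fun e he => by
      have := (hsupp e he).2.1
      zify at this
      linarith) ha hb
  have hX {a b : Fin 2 →₀ ℕ} (ha : a ∈ g.support) (hb : b ∈ h.support) :
      a 0 + b 0 ≤ 4 * L ^ 2 + 9 * L + 4 := by
    have := linearForm_add_le_of_mul 1 0 (4 * L ^ 2 + 9 * L + 4) (fun e he => by
      have := (hsupp e he).2.2
      zify at this
      linarith) ha hb
    zify
    linarith
  obtain ⟨n, hn⟩ : 4 * L + 3 ∣ v 0 := by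
    have hcop : Nat.Coprime (4 * L + 3) (4 * L + 5) := by
      rw [show 4 * L + 5 = 2 + (4 * L + 3) by ring, Nat.coprime_add_self_right,
        Nat.coprime_two_right]
      exact ⟨2 * L + 1, by ring⟩
    exact hcop.dvd_of_dvd_mul_left ⟨_, hline.symm⟩
  have hv0 : v 0 = n * (4 * L + 3) := by rw [hn, mul_comm]
  have hv1 : v 1 = n * (4 * L + 5) := by
    refine Nat.eq_of_mul_eq_mul_left (show 0 < 4 * L + 3 by omega) ?_
    rw [hline, hv0]
    ring
  have hxg (e) (he : e ∈ g.support) : e 0 ≤ n * (4 * L + 3) := by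
    have := hX he hw
    omega
  have hvz : (v 0 + w 0 : ℤ) = 4 * L ^ 2 + 9 * L + 4 := by exact_mod_cast hvw0
  have hvz1 : (v 1 + w 1 : ℤ) = (L + 1) * (4 * L + 7) := by exact_mod_cast hvw1
  have hlz : (4 * L + 3) * (v 1 : ℤ) = (4 * L + 5) * v 0 := by exact_mod_cast hline
  have hlg (e) (he : e ∈ g.support) : (4 * L + 3) * e 1 ≤ (4 * L + 5) * e 0 := by
    have := hL he hw
    zify
    linear_combination this + hlz - (4 * L + 3) * hvz1 + (4 * L + 5) * hvz
  rcases Nat.eq_zero_or_pos n with rfl | hpos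
  · have hC : g = C (coeff 0 g) := by
      ext e
      rw [coeff_C]
      split_ifs with h0
      · rw [h0]
      · by_contra hc
        have he := mem_support_iff.2 hc
        have h1 := hxg e he
        have h2 := hlg e he
        rw [zero_mul] at h1
        have h3 : e 0 = 0 := Nat.le_zero.1 h1
        rw [h3, mul_zero] at h2
        have h4 : e 1 = 0 := by
          rcases Nat.mul_eq_zero.1 (Nat.le_zero.1 h2) with h | h
          · omega
          · exact h
        apply h0
        ext l
        fin_cases l
        · exact h3.symm
        · exact h4.symm
    rw [hC]
    exact (isUnit_iff_ne_zero.2 (mem_support_iff.1 hg0)).map C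
  · exfalso
    have hnL : n ≤ L + 1 := by
      by_contra hc
      have : (L + 2) * (4 * L + 5) ≤ n * (4 * L + 5) := Nat.mul_le_mul_right _ (by omega)
      nlinarith
    refine mem_support_iff.1 hv (coeff_vertex_eq_zero L n hpos hnL g ?_ hxg hlg ?_ v hv0 hv1)
    · refine mem_span_pow_of_mul_mem (q := w 0) ?_ hh fun e he => ?_
      · rwa [← hv0, hvw0]
      · have := hX hv he
        omega
    · intro e he
      have h1 := hR he hw
      have h2 : (v 0 : ℤ) = n * (4 * L + 3) := by exact_mod_cast hv0
      have h3 : (v 1 : ℤ) = n * (4 * L + 5) := by exact_mod_cast hv1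
      rw [← h2, ← h3]
      linear_combination h1 + 2 * hvz1 - (4 * L + 7) * hvz

lemma irreducible_of_inTriangle (L : ℕ) {f : MvPolynomial (Fin 2) k} (hf0 : f ≠ 0)
    (hf : f ∈ (Ideal.span {X 0 - 1, X 1 - 1} : Ideal (MvPolynomial (Fin 2) k)) ^
      (4 * L ^ 2 + 9 * L + 4))
    (hsupp : ∀ e ∈ f.support, InTriangle L (e 0) (e 1)) : Irreducible f := by
  classical
  have hcol := columnSum_one_ne_zero L hf0 hf hsupp
  have hcolumn (i : ℕ) (hi : i ≤ 4 * L ^ 2 + 9 * L + 4) : ∃ e ∈ f.support, e 0 = i := by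
    obtain ⟨e, he, -⟩ := Finset.exists_ne_zero_of_sum_ne_zero (hcol i hi)
    exact ⟨e, (Finset.mem_filter.1 he).1, (Finset.mem_filter.1 he).2⟩
  have hzero (e) (he : e ∈ f.support) (h0 : e 0 = 0) : e = 0 := by
    have := (hsupp e he).1
    ext l
    fin_cases l
    · exact h0
    · change e 1 = 0
      by_contra hc
      have : (4 * L + 3) * 1 ≤ (4 * L + 3) * e 1 := Nat.mul_le_mul_left _ (by omega)
      rw [h0] at *
      omega
  have hf00 : 0 ∈ f.support := by
    obtain ⟨e, he, h0⟩ := hcolumn 0 (Nat.zero_le _)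
    rwa [hzero e he h0] at he
  obtain ⟨t, ht, ht0⟩ := hcolumn _ le_rfl
  have ht1 : t 1 = (L + 1) * (4 * L + 7) := by
    obtain ⟨h1, h2, -⟩ := hsupp t ht
    rw [ht0] at h1 h2
    nlinarith
  have haev : aeval ![(Polynomial.X : Polynomial k), 1] f ≠ 0 := by
    intro h
    have h := congrArg (Polynomial.coeff · 0) h
    rw [aeval_def, eval₂_eq'] at h
    simp only [Polynomial.finsetSum_coeff, Fin.prod_univ_two, Matrix.cons_val_zero,
      Matrix.cons_val_one, one_pow, mul_one, Polynomial.algebraMap_eq, Polynomial.coeff_C_mul,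
      Polynomial.coeff_X_pow, Polynomial.coeff_zero] at h
    rw [Finset.sum_eq_single_of_mem 0 hf00] at h
    · simp [mem_support_iff.1 hf00] at h
    · intro e he hne
      rw [if_neg fun h0 => hne (hzero e he h0.symm), mul_zero]
  rw [irreducible_iff]
  constructor
  · intro hu
    obtain ⟨c, -, rfl⟩ := isUnit_iff_eq_C_of_isReduced.1 hu
    have := mem_support_iff.1 ht
    rw [coeff_C] at this
    split_ifs at this with h
    · rw [← h, Finsupp.zero_apply] at ht0
      omega
    · exact this rfl
  · rintro g h rfl
    have hg0 : 0 ∈ g.support ∧ 0 ∈ h.support := by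
      have := mem_support_iff.1 hf00
      simp only [← constantCoeff_eq, map_mul] at this
      simp only [mem_support_iff, ← constantCoeff_eq]
      exact ⟨left_ne_zero_of_mul this, right_ne_zero_of_mul this⟩
    have htc := mem_support_iff.1 ht
    rw [coeff_mul] at htc
    obtain ⟨⟨v, w⟩, hvw, hne⟩ := Finset.exists_ne_zero_of_sum_ne_zero htc
    have hv := mem_support_iff.2 (left_ne_zero_of_mul hne)
    have hw := mem_support_iff.2 (right_ne_zero_of_mul hne)
    rw [Finset.HasAntidiagonal.mem_antidiagonal] at hvw
    rw [← hvw, Finsupp.add_apply] at ht0 ht1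
    simp only at hv hw ht0 ht1
    have hL {a b : Fin 2 →₀ ℕ} (ha : a ∈ g.support) (hb : b ∈ h.support) :
        -(4 * L + 5) * (a 0 + b 0 : ℤ) + (4 * L + 3) * (a 1 + b 1) ≤ 1 :=
      linearForm_add_le_of_mul _ _ 1 (fun e he => by
        have := (hsupp e he).1
        zify at this
        linarith) ha hb
    have h1 := hL hv hg0.2
    have h2 := hL hg0.1 hw
    have hvz : (v 0 + w 0 : ℤ) = 4 * L ^ 2 + 9 * L + 4 := by exact_mod_cast ht0
    have hvz1 : (v 1 + w 1 : ℤ) = (L + 1) * (4 * L + 7) := by exact_mod_cast ht1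
    simp only [Finsupp.coe_zero, Pi.zero_apply, Nat.cast_zero, add_zero, zero_add] at h1 h2
    have h3 : ((4 * L + 3) * v 1 - (4 * L + 5) * v 0 : ℤ) +
        ((4 * L + 3) * w 1 - (4 * L + 5) * w 0) = 1 := by
      linear_combination (4 * L + 3) * hvz1 - (4 * L + 5) * hvz
    rw [map_mul] at haev
    have h4 : ((4 * L + 3) * v 1 - (4 * L + 5) * v 0 : ℤ) = 0 ∨
        ((4 * L + 3) * w 1 - (4 * L + 5) * w 0 : ℤ) = 0 := by
      have h5 : ((4 * L + 3) * v 1 - (4 * L + 5) * v 0 : ℤ) ≤ 1 := by linarith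
      have h6 : ((4 * L + 3) * w 1 - (4 * L + 5) * w 0 : ℤ) ≤ 1 := by linarith
      omega
    rcases h4 with h4 | h4
    · left
      refine isUnit_of_vertex_on_line L hf hsupp (right_ne_zero_of_mul haev) hg0.1 hv hw ht0 ht1 ?_
      zify
      linarith
    · right
      rw [mul_comm g h] at hf hsupp
      refine isUnit_of_vertex_on_line L hf hsupp (left_ne_zero_of_mul haev) hg0.2 hw hv
        (by omega) (by omega) ?_
      zify
      linarith

end

theorem stmt5 (k : Type*) [Field k] [IsAlgClosed k] [CharZero k]
    (K : ℤ) (hK : 4 ≤ K) (hKeven : Even K)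
    (a b : ℤ) (m : ℕ) (ha : a = 2 * K - 3) (hb : b = 2 * K - 1)
    (hm : 2 * (m : ℤ) = 2 * K ^ 2 - 7 * K + 4)
    (f : MvPolynomial (Fin 2) k) (hf0 : f ≠ 0)
    (hsupp : ∀ e ∈ f.support,
      ((e 0 : ℝ), (e 1 : ℝ)) ∈ convexHull ℝ
        ({(-1 / (a : ℝ), 0), ((m : ℝ) - (K : ℝ) + 2, 0),
          ((m : ℝ), ((K : ℝ) - 2) * (b : ℝ) / 2)} : Set (ℝ × ℝ)))
    (hvan : f ∈ (Ideal.span {X 0 - 1, X 1 - 1} : Ideal (MvPolynomial (Fin 2) k)) ^ m) :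
    Irreducible f := by
  obtain ⟨L, rfl⟩ : ∃ L : ℕ, K = 2 * L + 4 := by
    obtain ⟨c, rfl⟩ := hKeven
    exact ⟨(c - 2).toNat, by omega⟩
  obtain rfl : m = 4 * L ^ 2 + 9 * L + 4 := by
    zify
    linarith
  subst ha hb
  refine irreducible_of_inTriangle L hf0 hvan fun e he => ?_
  have hhalf (α β c : ℝ) (h1 : α * (-1 / (4 * L + 5)) ≤ c)
      (h2 : α * (4 * L ^ 2 + 7 * L + 2) ≤ c)
      (h3 : α * (4 * L ^ 2 + 9 * L + 4) + β * ((L + 1) * (4 * L + 7)) ≤ c) :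
      α * (e 0 : ℝ) + β * (e 1 : ℝ) ≤ c := by
    have hconv : Convex ℝ {p : ℝ × ℝ | (α • LinearMap.fst ℝ ℝ ℝ + β • LinearMap.snd ℝ ℝ ℝ) p ≤ c} :=
      convex_halfSpace_le (LinearMap.isLinear _) c
    have := convexHull_min ?_ hconv (hsupp e he)
    · simpa using this
    · rintro p (rfl | rfl | rfl)
      · change α * (-1 / ((2 * (2 * (L : ℤ) + 4) - 3 : ℤ) : ℝ)) + β * 0 ≤ c
        rw [mul_zero, add_zero]
        push_cast
        rwa [show (2 * (2 * (L : ℝ) + 4) - 3) = 4 * L + 5 by ring]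
      · change α * _ + β * 0 ≤ c
        push_cast
        linarith
      · change α * _ + β * _ ≤ c
        push_cast
        linarith
  have hL : (0 : ℝ) ≤ L := Nat.cast_nonneg L
  have h1 := hhalf (-(4 * L + 5)) (4 * L + 3) 1 (by field_simp; norm_num)
    (by nlinarith) (by nlinarith)
  have h2 := hhalf (4 * L + 7) (-2) ((4 * L + 7) * (4 * L ^ 2 + 7 * L + 2))
    (by
      refine (mul_nonpos_of_nonneg_of_nonpos (by positivity) ?_).trans (by positivity)
      exact div_nonpos_of_nonpos_of_nonneg (by norm_num) (by positivity)) le_rfl (by nlinarith)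
  have h3 := hhalf 1 0 (4 * L ^ 2 + 9 * L + 4)
    (by
      refine le_trans ?_ (show (0 : ℝ) ≤ _ by positivity)
      rw [one_mul]
      exact div_nonpos_of_nonpos_of_nonneg (by norm_num) (by positivity))
    (by linarith) (by linarith)
  refine ⟨?_, ?_, ?_⟩
  · rify
    linarith
  · rify
    linarith
  · rify
    linarith
end

section
/- Let k be an algebraically closed field of characteristic zero. Let K >= 5 be an odd integer, set a = 2K-3, c = 4K^2-16K+11, d = 2K-5, m = ceil(K^2 - (7/2)K + 2), and let Delta_K be the triangle with vertices (0,0), (m-K+2, 0), ((K-1)/2 + 1/c)*(d,a). If f ∈ k[x,y] is a nonzero polynomial supported in Delta_K that vanishes to order at least m at e = (1,1), then f is irreducible. -/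
open MvPolynomial

section Blowup

variable {k : Type*} [Field k]

/-- The substitution `x ↦ x`, `y ↦ 1 + (x - 1) v`, a chart of the blowup of the plane at `(1, 1)`,
valued in polynomials in `v` over `k[x]`. -/
noncomputable def blowupChart : MvPolynomial (Fin 2) k →ₐ[k] Polynomial (Polynomial k) :=
  aeval ![Polynomial.C Polynomial.X,
    1 + Polynomial.C (Polynomial.X - 1) * Polynomial.X]

/-- The coefficient of `(y - 1) ^ r` in `f`, as a polynomial in `x`. -/
noncomputable def moment (r : ℕ) (f : MvPolynomial (Fin 2) k) : Polynomial k :=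
  ∑ e ∈ f.support, Polynomial.monomial (e 0) (coeff e f * ((e 1).choose r : k))

/-- The coefficient of `x ^ i` in `f`, as a polynomial in `y`. -/
noncomputable def column (i : ℕ) (f : MvPolynomial (Fin 2) k) : Polynomial k :=
  ∑ e ∈ f.support with e 0 = i, Polynomial.monomial (e 1) (coeff e f)

theorem coeff_blowupChart (f : MvPolynomial (Fin 2) k) (r : ℕ) :
    (blowupChart f).coeff r = (Polynomial.X - 1) ^ r * moment r f := by
  have key : ∀ (q : Polynomial k) (n : ℕ),
      ((1 + Polynomial.C q * Polynomial.X) ^ n).coeff r = (n.choose r : Polynomial k) * q ^ r := by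
    intro q n
    have h : ((1 + Polynomial.C q * Polynomial.X) ^ n) =
        ((1 + Polynomial.X : Polynomial (Polynomial k)) ^ n).comp
          (Polynomial.C q * Polynomial.X) := by
      simp
    rw [h, Polynomial.comp_C_mul_X_coeff, Polynomial.coeff_one_add_X_pow]
  rw [blowupChart, aeval_def, eval₂_eq', Polynomial.finsetSum_coeff, moment, Finset.mul_sum]
  refine Finset.sum_congr rfl fun e _ => ?_
  simp only [Fin.prod_univ_two, Matrix.cons_val_zero, Matrix.cons_val_one]
  rw [← Polynomial.C_pow, Polynomial.algebraMap_apply, Polynomial.coeff_C_mul,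
    Polynomial.coeff_C_mul, key, ← Polynomial.C_mul_X_pow_eq_monomial]
  simp only [Polynomial.algebraMap_eq, map_mul, map_natCast]
  ring

theorem coeff_zero_blowupChart (f : MvPolynomial (Fin 2) k) :
    (blowupChart f).coeff 0 = moment 0 f := by
  simp [coeff_blowupChart]

theorem moment_zero_mul (g h : MvPolynomial (Fin 2) k) :
    moment 0 (g * h) = moment 0 g * moment 0 h := by
  simp only [← coeff_zero_blowupChart, map_mul, Polynomial.mul_coeff_zero]

theorem pow_dvd_blowupChart {f : MvPolynomial (Fin 2) k} {m : ℕ}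
    (hf : f ∈ (Ideal.span {X 0 - 1, X 1 - 1} : Ideal (MvPolynomial (Fin 2) k)) ^ m) :
    Polynomial.C (Polynomial.X - 1) ^ m ∣ blowupChart f := by
  have hle : (Ideal.span {X 0 - 1, X 1 - 1} : Ideal (MvPolynomial (Fin 2) k)).map
      (blowupChart (k := k)) ≤ Ideal.span {Polynomial.C (Polynomial.X - 1)} := by
    rw [Ideal.map_span, Ideal.span_le]
    rintro _ ⟨p, rfl | rfl, rfl⟩
    · simp [blowupChart]
    · simp [blowupChart, Ideal.mem_span_singleton]
  have := Ideal.mem_map_of_mem (blowupChart (k := k)) hf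
  rw [Ideal.map_pow] at this
  have := Ideal.pow_right_mono hle m this
  rwa [Ideal.span_singleton_pow, Ideal.mem_span_singleton] at this

theorem pow_sub_dvd_moment {f : MvPolynomial (Fin 2) k} {N : ℕ}
    (hf : Polynomial.C (Polynomial.X - 1) ^ N ∣ blowupChart f) (r : ℕ) :
    (Polynomial.X - 1) ^ (N - r) ∣ moment r f := by
  have hne : (Polynomial.X - 1 : Polynomial k) ≠ 0 := Polynomial.X_sub_C_ne_zero 1
  rcases le_total N r with h | h
  · simp [Nat.sub_eq_zero_of_le h]
  rw [← Polynomial.C_pow, Polynomial.C_dvd_iff_dvd_coeff] at hf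
  have := hf r
  rw [coeff_blowupChart] at this
  nth_rewrite 1 [← Nat.add_sub_cancel' h] at this
  rw [pow_add] at this
  exact (mul_dvd_mul_iff_left (pow_ne_zero _ hne)).1 this

theorem coeff_column (f : MvPolynomial (Fin 2) k) (i l : ℕ) :
    (column i f).coeff l = ∑ e ∈ f.support with e 0 = i ∧ e 1 = l, coeff e f := by
  simp [column, Polynomial.coeff_monomial, Finset.sum_ite, Finset.filter_filter]

theorem coeff_moment (f : MvPolynomial (Fin 2) k) (r i : ℕ) :
    (moment r f).coeff i = (Polynomial.taylor 1 (column i f)).coeff r := by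
  simp only [moment, column, Polynomial.finsetSum_coeff, map_sum, Polynomial.coeff_monomial,
    Finset.sum_filter]
  refine Finset.sum_congr rfl fun e _ => ?_
  split_ifs <;> simp [Polynomial.taylor_monomial, Polynomial.coeff_X_add_one_pow]

theorem exists_mem_support_of_coeff_moment_ne_zero {f : MvPolynomial (Fin 2) k} {r i : ℕ}
    (h : (moment r f).coeff i ≠ 0) : ∃ e ∈ f.support, e 0 = i ∧ r ≤ e 1 := by
  rw [moment, Polynomial.finsetSum_coeff] at h
  obtain ⟨e, he, hne⟩ := Finset.exists_ne_zero_of_sum_ne_zero h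
  rw [Polynomial.coeff_monomial] at hne
  refine ⟨e, he, ?_, ?_⟩
  · by_contra h'
    simp [h'] at hne
  · by_contra h'
    simp [Nat.choose_eq_zero_of_lt (not_le.1 h')] at hne

theorem exists_mem_support_of_coeff_column_ne_zero {f : MvPolynomial (Fin 2) k} {i l : ℕ}
    (h : (column i f).coeff l ≠ 0) : ∃ e ∈ f.support, e 0 = i ∧ e 1 = l := by
  rw [coeff_column] at h
  obtain ⟨e, he, -⟩ := Finset.exists_ne_zero_of_sum_ne_zero h
  exact ⟨e, (Finset.mem_filter.1 he).1, (Finset.mem_filter.1 he).2⟩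

theorem natDegree_moment_le {f : MvPolynomial (Fin 2) k} {N : ℕ} (hf : ∀ e ∈ f.support, e 0 ≤ N)
    (r : ℕ) : (moment r f).natDegree ≤ N := by
  rw [Polynomial.natDegree_le_iff_coeff_eq_zero]
  intro i hi
  by_contra h
  obtain ⟨e, he, h0, -⟩ := exists_mem_support_of_coeff_moment_ne_zero h
  have := hf e he
  omega

theorem exists_moment_ne_zero {f : MvPolynomial (Fin 2) k} (hf : f ≠ 0) : ∃ r, moment r f ≠ 0 := by
  by_contra! h
  obtain ⟨e, he⟩ := support_nonempty.2 hf
  have hcol : column (e 0) f = 0 := by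
    apply Polynomial.taylor_injective (1 : k)
    ext r
    rw [← coeff_moment, h]
    simp
  have hc := coeff_column f (e 0) (e 1)
  have hs : {e' ∈ f.support | e' 0 = e 0 ∧ e' 1 = e 1} = {e} := by
    ext e'
    simp only [Finset.mem_filter, Finset.mem_singleton]
    refine ⟨fun h' => Finsupp.ext fun i => ?_, by rintro rfl; exact ⟨he, rfl, rfl⟩⟩
    fin_cases i
    exacts [h'.2.1, h'.2.2]
  rw [hs, hcol, Finset.sum_singleton, Polynomial.coeff_zero] at hc
  exact mem_support_iff.1 he hc.symm

/-- Weights attain their maxima over the supports of two factors at exponents whose sum is an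
exponent of the product. -/
theorem exists_max_weight_add_mem_support {σ : Type*} [LinearOrder σ] [WellFoundedGT σ]
    {g h : MvPolynomial σ k} (hg : g ≠ 0) (hh : h ≠ 0) (w : (σ →₀ ℕ) →+ ℤ) :
    ∃ p ∈ g.support, ∃ q ∈ h.support, (∀ e ∈ g.support, w e ≤ w p) ∧
      (∀ e ∈ h.support, w e ≤ w q) ∧ p + q ∈ (g * h).support := by
  classical
  let o := (MonomialOrder.lex (σ := σ)).toSyn
  have key : ∀ s : Finset (σ →₀ ℕ), s.Nonempty →
      ∃ p ∈ s, ∀ e ∈ s, w e ≤ w p ∧ (w e = w p → o e ≤ o p) := by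
    intro s hs
    obtain ⟨p, hp, hpmax⟩ := s.exists_max_image w hs
    obtain ⟨q, hq, hqmax⟩ := (s.filter (fun e => w e = w p)).exists_max_image o
      ⟨p, Finset.mem_filter.2 ⟨hp, rfl⟩⟩
    obtain ⟨hqs, hqw⟩ := Finset.mem_filter.1 hq
    exact ⟨q, hqs, fun e he => ⟨hqw ▸ hpmax e he,
      fun h' => hqmax e (Finset.mem_filter.2 ⟨he, h'.trans hqw⟩)⟩⟩
  obtain ⟨p, hp, hpmax⟩ := key _ (support_nonempty.2 hg)
  obtain ⟨q, hq, hqmax⟩ := key _ (support_nonempty.2 hh)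
  refine ⟨p, hp, q, hq, fun e he => (hpmax e he).1, fun e he => (hqmax e he).1, ?_⟩
  rw [mem_support_iff, coeff_mul, Finset.sum_eq_single (p, q)]
  · exact mul_ne_zero (mem_support_iff.1 hp) (mem_support_iff.1 hq)
  · rintro ⟨p', q'⟩ hmem hne
    rw [Finset.HasAntidiagonal.mem_antidiagonal] at hmem
    simp only at hmem
    by_contra h0
    have hp' := mem_support_iff.2 (left_ne_zero_of_mul h0)
    have hq' := mem_support_iff.2 (right_ne_zero_of_mul h0)
    have hw := congrArg w hmem
    have ho := congrArg o hmem
    rw [map_add, map_add] at hw ho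
    have h1 := hpmax p' hp'
    have h2 := hqmax q' hq'
    have hp2 := h1.2 (by linarith [h1.1, h2.1])
    have hq2 := h2.2 (by linarith [h1.1, h2.1])
    have e1 : o p' = o p := by
      refine le_antisymm hp2 (le_of_not_gt fun hlt => ?_)
      exact absurd ho (add_lt_add_of_lt_of_le hlt hq2).ne
    have e2 : o q' = o q := by
      rw [e1] at ho
      exact add_left_cancel ho
    exact hne (Prod.ext (o.injective e1) (o.injective e2))
  · intro h'
    exact absurd (by simp) h'

theorem eq_C_mul_of_X_pow_dvd_of_X_sub_one_pow_dvd {p : Polynomial k} {i j : ℕ}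
    (hdeg : p.natDegree ≤ i + j) (hi : Polynomial.X ^ i ∣ p) (hj : (Polynomial.X - 1) ^ j ∣ p) :
    p = Polynomial.C (p.coeff (i + j)) * (Polynomial.X ^ i * (Polynomial.X - 1) ^ j) := by
  have hcop : IsCoprime (Polynomial.X ^ i : Polynomial k) ((Polynomial.X - 1) ^ j) :=
    IsCoprime.pow ⟨1, -1, by ring⟩
  have hmonic : (Polynomial.X ^ i * (Polynomial.X - 1) ^ j : Polynomial k).Monic :=
    (Polynomial.monic_X_pow i).mul ((Polynomial.monic_X_sub_C (1 : k)).pow j)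
  have hnat : (Polynomial.X ^ i * (Polynomial.X - 1) ^ j : Polynomial k).natDegree = i + j := by
    have h1 : (Polynomial.X - 1 : Polynomial k).natDegree = 1 := Polynomial.natDegree_X_sub_C 1
    have h2 : (Polynomial.X - 1 : Polynomial k).Monic := Polynomial.monic_X_sub_C 1
    rw [(Polynomial.monic_X_pow i).natDegree_mul (h2.pow j), h2.natDegree_pow, h1]
    simp
  obtain ⟨q, hq⟩ := hcop.mul_dvd hi hj
  have hq0 : q.natDegree = 0 := by
    by_cases h0 : q = 0
    · simp [h0]
    · have := hmonic.natDegree_mul' h0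
      rw [← hq, hnat] at this
      omega
  obtain ⟨a, rfl⟩ := Polynomial.natDegree_eq_zero.1 hq0
  have hc : p.coeff (i + j) = a := by
    rw [hq, Polynomial.coeff_mul_C, ← hnat, hmonic.coeff_natDegree, one_mul]
  rw [hc, hq, mul_comm]

theorem coeff_pred_of_X_pow_dvd_of_X_sub_one_pow_dvd {p : Polynomial k} {i j : ℕ}
    (hdeg : p.natDegree ≤ i + j) (hi : Polynomial.X ^ i ∣ p) (hj : (Polynomial.X - 1) ^ j ∣ p)
    (hij : 0 < i + j) : p.coeff (i + j - 1) = -(j : k) * p.coeff (i + j) := by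
  have h := eq_C_mul_of_X_pow_dvd_of_X_sub_one_pow_dvd hdeg hi hj
  generalize p.coeff (i + j) = a at h
  rw [h, Polynomial.coeff_C_mul, mul_comm a]
  congr 1
  rw [mul_comm, Polynomial.coeff_mul_X_pow']
  rcases Nat.eq_zero_or_pos j with rfl | hj0
  · rw [if_neg (by omega)]
    simp
  · have h1 : (Polynomial.X - 1 : Polynomial k) = Polynomial.X + Polynomial.C (-1) := by
      simp [sub_eq_add_neg]
    rw [if_pos (by omega), h1, Polynomial.coeff_X_add_C_pow]
    have h2 : i + j - 1 - i = j - 1 := by omega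
    have h3 : j - (j - 1) = 1 := by omega
    have h4 : j.choose (j - 1) = j := by
      rw [Nat.choose_symm_of_eq_add (show j = (j - 1) + 1 by omega), Nat.choose_one_right]
    rw [h2, h3, h4]
    ring


theorem natTrailingDegree_add_le_natDegree {p : Polynomial k} {n : ℕ} (hp : p ≠ 0)
    (h : (Polynomial.X - 1) ^ n ∣ p) : p.natTrailingDegree + n ≤ p.natDegree := by
  have hcop : IsCoprime (Polynomial.X ^ p.natTrailingDegree : Polynomial k)
      ((Polynomial.X - 1) ^ n) := IsCoprime.pow ⟨1, -1, by ring⟩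
  have hX : Polynomial.X ^ p.natTrailingDegree ∣ p :=
    Polynomial.X_pow_dvd_iff.2 fun _ h => Polynomial.coeff_eq_zero_of_lt_natTrailingDegree h
  have h1 : (Polynomial.X - 1 : Polynomial k).natDegree = 1 := Polynomial.natDegree_X_sub_C 1
  have h2 : (Polynomial.X - 1 : Polynomial k).Monic := Polynomial.monic_X_sub_C 1
  have hle := Polynomial.natDegree_le_of_dvd (hcop.mul_dvd hX h) hp
  rw [(Polynomial.monic_X_pow _).natDegree_mul (h2.pow n), h2.natDegree_pow, h1] at hle
  simpa using hle

theorem X_sub_one_pow_dvd_iff_coeff_taylor {p : Polynomial k} {n : ℕ} :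
    (Polynomial.X - 1) ^ n ∣ p ↔ ∀ r < n, (Polynomial.taylor 1 p).coeff r = 0 := by
  rw [← Polynomial.X_pow_dvd_iff, ← Polynomial.C_1, Polynomial.X_sub_C_pow_dvd_iff,
    Polynomial.taylor_apply]

/-- If the moments of order below `r` vanish, then every column on which the moment of order `r`
does not vanish has height at least `r`. -/
theorem exists_mem_support_add_le {f : MvPolynomial (Fin 2) k} {r i : ℕ}
    (hlt : ∀ s < r, moment s f = 0) (hr : (moment r f).coeff i ≠ 0) :
    ∃ p ∈ f.support, ∃ q ∈ f.support, p 0 = i ∧ q 0 = i ∧ p 1 + r ≤ q 1 := by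
  have hdvd : (Polynomial.X - 1) ^ r ∣ column i f :=
    X_sub_one_pow_dvd_iff_coeff_taylor.2 fun s hs => by rw [← coeff_moment, hlt s hs]; simp
  have hne : column i f ≠ 0 := by
    intro h0
    rw [coeff_moment, h0] at hr
    simp at hr
  have hle := natTrailingDegree_add_le_natDegree hne hdvd
  obtain ⟨p, hp, hp0, hp1⟩ := exists_mem_support_of_coeff_column_ne_zero
    (show (column i f).coeff (column i f).natTrailingDegree ≠ 0 from
      Polynomial.trailingCoeff_nonzero_iff_nonzero.2 hne)
  obtain ⟨q, hq, hq0, hq1⟩ := exists_mem_support_of_coeff_column_ne_zero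
    (show (column i f).coeff (column i f).natDegree ≠ 0 from Polynomial.leadingCoeff_ne_zero.2 hne)
  exact ⟨p, hp, q, hq, hp0, hq0, by omega⟩

/-- In the triangle, a pair of columns whose distance is at least `m - r` cannot both have height at
least `r`. -/
theorem not_column_heights {n m r i D q1 q1' p1' : ℤ} (hn : 2 ≤ n) (hr : 1 ≤ r)
    (hD : D ≤ m) (hwd : m - r ≤ D - i) (hm : m = n * (4 * n - 3)) (hq : r ≤ q1)
    (hp : p1' + r ≤ q1') (l1 : (4 * n - 3) * q1 ≤ (4 * n - 1) * i)
    (l2 : (4 * n - 3) * q1' ≤ (4 * n - 1) * D)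
    (l3 : (4 * n + 1) * D - 2 * p1' ≤ n * (16 * n ^ 2 - 16 * n - 1) + 1) : False := by
  obtain ⟨t, rfl⟩ : ∃ t, D = m - t := ⟨m - D, by ring⟩
  obtain ⟨s, rfl⟩ : ∃ s, r = i + s := ⟨r - i, by ring⟩
  obtain ⟨u, rfl⟩ : ∃ u, q1' = n * (4 * n - 1) - u := ⟨n * (4 * n - 1) - q1', by ring⟩
  obtain ⟨v, rfl⟩ : ∃ v, p1' = n * (4 * n - 1) - v := ⟨n * (4 * n - 1) - p1', by ring⟩
  subst hm
  have hts : t ≤ s := by linarith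
  have ht : 0 ≤ t := by linarith
  have h1 : (4 * n - 3) * s ≤ 2 * i := by nlinarith
  have h2 : (4 * n - 1) * t ≤ (4 * n - 3) * u := by nlinarith
  have h3 : 2 * v ≤ (4 * n + 1) * t + 1 := by nlinarith
  have h4 : i + s + u ≤ v := by linarith
  have h5 : (4 * n - 1) * (s - t) + 2 * u ≤ 2 * t + 1 := by nlinarith
  have h6 : 0 ≤ (4 * n - 1) * (s - t) := mul_nonneg (by linarith) (by linarith)
  rcases ht.eq_or_lt with rfl | ht0
  · have hu : 0 ≤ u := by
      by_contra! hu
      have := mul_neg_of_pos_of_neg (show 0 < 4 * n - 3 by linarith) hu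
      linarith
    have hs : s = 0 := by
      by_contra! hs
      have := mul_le_mul_of_nonneg_left (show 1 ≤ s by omega) (show 0 ≤ 4 * n - 1 by linarith)
      linarith
    subst hs
    linarith
  · have hu : t + 1 ≤ u := by
      by_contra! hu
      have := mul_le_mul_of_nonneg_left (show u ≤ t by omega) (show 0 ≤ 4 * n - 3 by linarith)
      linarith
    linarith

theorem moment_zero_ne_zero {n m : ℕ} (hn : 2 ≤ n) (hm : (m : ℤ) = n * (4 * n - 3))
    {f : MvPolynomial (Fin 2) k} (hf : f ≠ 0)
    (hleft : ∀ e ∈ f.support, (4 * n - 3 : ℤ) * e 1 ≤ (4 * n - 1) * e 0)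
    (hwidth : ∀ e ∈ f.support, e 0 ≤ m)
    (hright : ∀ e ∈ f.support,
      (4 * n + 1 : ℤ) * e 0 - 2 * e 1 ≤ n * (16 * n ^ 2 - 16 * n - 1) + 1)
    (hdvd : Polynomial.C (Polynomial.X - 1) ^ m ∣ blowupChart f) : moment 0 f ≠ 0 := by
  classical
  have hex := exists_moment_ne_zero hf
  have hne := Nat.find_spec hex
  have hlt : ∀ s < Nat.find hex, moment s f = 0 := fun s hs => not_not.1 (Nat.find_min hex hs)
  generalize Nat.find hex = r at hne hlt
  rcases Nat.eq_zero_or_pos r with rfl | hr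
  · exact hne
  exfalso
  have hle := natTrailingDegree_add_le_natDegree hne (pow_sub_dvd_moment hdvd r)
  obtain ⟨p, hp, q, hq, hp0, hq0, hpq⟩ := exists_mem_support_add_le hlt
    (show (moment r f).coeff (moment r f).natTrailingDegree ≠ 0 from
      Polynomial.trailingCoeff_nonzero_iff_nonzero.2 hne)
  obtain ⟨p', hp', q', hq', hp0', hq0', hpq'⟩ := exists_mem_support_add_le hlt
    (show (moment r f).coeff (moment r f).natDegree ≠ 0 from Polynomial.leadingCoeff_ne_zero.2 hne)
  have hX := natDegree_moment_le hwidth r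
  have l1 := hleft q hq
  have l2 := hleft q' hq'
  have l3 := hright p' hp'
  rw [hq0] at l1
  rw [hq0'] at l2
  rw [hp0'] at l3
  generalize (moment r f).natDegree = D at *
  generalize (moment r f).natTrailingDegree = i at *
  have hqr : (r : ℤ) ≤ q 1 := by omega
  have hpr' : (p' 1 : ℤ) + r ≤ q' 1 := by exact_mod_cast hpq'
  have hwd : (m : ℤ) - r ≤ D - i := by omega
  have hD : (D : ℤ) ≤ m := by exact_mod_cast hX
  have hn' : (2 : ℤ) ≤ n := by exact_mod_cast hn
  have hr' : (1 : ℤ) ≤ r := by exact_mod_cast hr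
  exact not_column_heights hn' hr' hD hwd hm hqr hpr' l1 l2 l3

theorem moment_zero_eq_zero_of_support_subset [CharZero k] {n j N : ℕ} (hn : 2 ≤ n) (hj : 1 ≤ j)
    (hN : (N : ℤ) = j * (4 * n - 3)) {g : MvPolynomial (Fin 2) k}
    (hleft : ∀ e ∈ g.support, (4 * n - 3 : ℤ) * e 1 ≤ (4 * n - 1) * e 0)
    (hwidth : ∀ e ∈ g.support, e 0 ≤ N)
    (hright : ∀ e ∈ g.support,
      (4 * n + 1 : ℤ) * e 0 - 2 * e 1 ≤ j * (16 * n ^ 2 - 16 * n - 1))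
    (hdvd : Polynomial.C (Polynomial.X - 1) ^ N ∣ blowupChart g) : moment 0 g = 0 := by
  have hn' : (2 : ℤ) ≤ n := by exact_mod_cast hn
  have hj' : (1 : ℤ) ≤ j := by exact_mod_cast hj
  obtain ⟨B, hB⟩ : ∃ B : ℕ, (B : ℤ) = j * (4 * n - 1) - 2 * n :=
    ⟨(j * (4 * n - 1) - 2 * n : ℤ).toNat, Int.toNat_of_nonneg (by nlinarith)⟩
  have hNn : 2 * n ≤ N := by
    zify
    nlinarith
  have hX : ∀ r < 2 * n, Polynomial.X ^ r ∣ moment r g := by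
    intro r hr
    rw [Polynomial.X_pow_dvd_iff]
    intro i hi
    by_contra h
    obtain ⟨e, he, he0, he1⟩ := exists_mem_support_of_coeff_moment_ne_zero h
    have := hleft e he
    rw [he0] at this
    have hi' : (i : ℤ) + 1 ≤ e 1 := by omega
    have hi2 : (i : ℤ) ≤ 2 * n - 2 := by omega
    nlinarith
  have htop : ∀ e ∈ g.support, e 0 = N → e 1 = B + 2 * n := by
    intro e he h0
    have h1 := hleft e he
    have h2 := hright e he
    rw [h0, hN] at h1 h2
    have h3 : (e 1 : ℤ) ≤ j * (4 * n - 1) := by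
      by_contra! h
      nlinarith
    have h4 : (j * (4 * n - 1) : ℤ) ≤ e 1 := by nlinarith
    zify
    rw [hB]
    linarith
  have hcolN : column N g =
      Polynomial.monomial (B + 2 * n) ((moment 0 g).coeff N) := by
    have h1 : column N g =
        Polynomial.monomial (B + 2 * n) (∑ e ∈ g.support with e 0 = N, coeff e g) := by
      rw [column, map_sum]
      refine Finset.sum_congr rfl fun e he => ?_
      rw [htop e (Finset.mem_filter.1 he).1 (Finset.mem_filter.1 he).2]
    rw [coeff_moment, Polynomial.taylor_coeff_zero, h1, Polynomial.eval_monomial, one_pow,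
      mul_one]
  set γ := (moment 0 g).coeff N with hγ
  have hmomN : ∀ r, (moment r g).coeff N = γ * ((B + 2 * n).choose r : k) := by
    intro r
    rw [coeff_moment, hcolN, Polynomial.taylor_monomial, Polynomial.coeff_C_mul, map_one,
      Polynomial.coeff_X_add_one_pow]
  have hmom : ∀ r < 2 * n, (moment r g).coeff (N - 1) =
      -((N : k) - r) * (γ * ((B + 2 * n).choose r : k)) := by
    intro r hr
    have hrN : r + (N - r) = N := by omega
    have := coeff_pred_of_X_pow_dvd_of_X_sub_one_pow_dvd (j := N - r)
      (by rw [hrN]; exact natDegree_moment_le hwidth r) (hX r hr) (pow_sub_dvd_moment hdvd r)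
      (by omega)
    rwa [hrN, hmomN, Nat.cast_sub (by omega)] at this
  have hcol : ∀ l, (column (N - 1) g).coeff l ≠ 0 → B ≤ l ∧ l + 2 ≤ B + 2 * n := by
    intro l hl
    obtain ⟨e, he, he0, rfl⟩ := exists_mem_support_of_coeff_column_ne_zero hl
    have h1 := hleft e he
    have h2 := hright e he
    have h0 : (e 0 : ℤ) = j * (4 * n - 3) - 1 := by omega
    rw [h0] at h1 h2
    have h3 : (e 1 : ℤ) + 2 ≤ j * (4 * n - 1) := by
      by_contra! h
      nlinarith
    have h4 : (j * (4 * n - 1) : ℤ) - 2 * n ≤ e 1 := by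
      by_contra! h
      nlinarith
    constructor <;> zify <;> rw [hB] <;> linarith
  obtain ⟨A, hA⟩ : ∃ A, B + 2 * n = A + 1 := ⟨B + 2 * n - 1, by omega⟩
  let P : Polynomial k := column (N - 1) g + Polynomial.C γ *
    (Polynomial.C ((N : k) - (A + 1 : ℕ)) * Polynomial.X ^ (A + 1) +
      Polynomial.C ((A + 1 : ℕ) : k) * Polynomial.X ^ A)
  have hP : ∀ l, P.coeff l = (column (N - 1) g).coeff l +
      γ * (((N : k) - (A + 1 : ℕ)) * (if l = A + 1 then 1 else 0) +
        (A + 1 : ℕ) * (if l = A then 1 else 0)) := by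
    intro l
    simp only [P, Polynomial.coeff_add, Polynomial.coeff_C_mul, Polynomial.coeff_X_pow]
  have hPX : Polynomial.X ^ B ∣ P := by
    rw [Polynomial.X_pow_dvd_iff]
    intro l hl
    rw [hP, if_neg (by omega), if_neg (by omega)]
    by_contra h
    have := hcol l (by simpa using h)
    omega
  have hPdeg : P.natDegree ≤ B + 2 * n := by
    rw [Polynomial.natDegree_le_iff_coeff_eq_zero]
    intro l hl
    rw [hP, if_neg (by omega), if_neg (by omega)]
    by_contra h
    have := hcol l (by simpa using h)
    omega
  have hPY : (Polynomial.X - 1) ^ (2 * n) ∣ P := by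
    rw [X_sub_one_pow_dvd_iff_coeff_taylor]
    intro r hr
    have h1 := hmom r hr
    rw [coeff_moment, hA] at h1
    have h2 : (A.choose r : k) * (A + 1 : ℕ) = ((A + 1).choose r : k) * ((A + 1 : ℕ) - r) := by
      rw [← Nat.cast_sub (by omega)]
      exact_mod_cast Nat.choose_mul_succ_eq A r
    simp only [P, map_add, Polynomial.taylor_mul, Polynomial.taylor_C, Polynomial.taylor_X_pow,
      Polynomial.coeff_add, Polynomial.coeff_C_mul, h1, Polynomial.C_1,
      Polynomial.coeff_X_add_one_pow]
    linear_combination γ * h2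
  have hc := coeff_pred_of_X_pow_dvd_of_X_sub_one_pow_dvd hPdeg hPX hPY (by omega)
  have hc1 : (column (N - 1) g).coeff (A + 1) = 0 := by
    by_contra h
    have := hcol _ h
    omega
  have hc2 : (column (N - 1) g).coeff A = 0 := by
    by_contra h
    have := hcol _ h
    omega
  rw [hA, Nat.add_sub_cancel, hP, hP, hc1, hc2, if_neg (by omega), if_pos rfl, if_pos rfl,
    if_neg (by omega)] at hc
  have hγ0 : γ = 0 := by
    have hAk : ((A + 1 : ℕ) : k) = j * (4 * n - 1) := by
      have : ((A + 1 : ℕ) : ℤ) = j * (4 * n - 1) := by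
        rw [← hA]
        push_cast
        rw [hB]
        ring
      exact_mod_cast congrArg (Int.cast : ℤ → k) this
    have hNk : (N : k) = j * (4 * n - 3) := by exact_mod_cast congrArg (Int.cast : ℤ → k) hN
    rw [hAk, hNk, Nat.cast_mul] at hc
    have : (j : k) * γ = 0 := by linear_combination -hc
    exact (mul_eq_zero.1 this).resolve_left (Nat.cast_ne_zero.2 (by omega))
  have := eq_C_mul_of_X_pow_dvd_of_X_sub_one_pow_dvd (i := 0) (j := N)
    (by rw [zero_add]; exact natDegree_moment_le hwidth 0) (by simp)
    (by simpa using pow_sub_dvd_moment hdvd 0)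
  rw [this, zero_add, ← hγ, hγ0]
  simp


theorem exists_add_eq_of_pow_dvd_mul {R : Type*} [CommRing R] [IsDomain R] {p a b : R}
    (hp : Prime p) {m : ℕ} (h : p ^ m ∣ a * b) : ∃ i j, i + j = m ∧ p ^ i ∣ a ∧ p ^ j ∣ b := by
  induction m generalizing a b with
  | zero => exact ⟨0, 0, rfl, by simp, by simp⟩
  | succ m ih =>
    rcases hp.dvd_or_dvd ((dvd_pow_self p m.succ_ne_zero).trans h) with ⟨c, rfl⟩ | ⟨c, rfl⟩
    · rw [pow_succ', mul_assoc, mul_dvd_mul_iff_left hp.ne_zero] at h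
      obtain ⟨i, j, rfl, hi, hj⟩ := ih h
      exact ⟨i + 1, j, by ring, by rw [pow_succ']; exact mul_dvd_mul_left p hi, hj⟩
    · rw [pow_succ', mul_left_comm, mul_dvd_mul_iff_left hp.ne_zero] at h
      obtain ⟨i, j, rfl, hi, hj⟩ := ih h
      exact ⟨i, j + 1, by ring, hi, by rw [pow_succ']; exact mul_dvd_mul_left p hj⟩

theorem isUnit_moment_zero {g : MvPolynomial (Fin 2) k} (hg : IsUnit g) :
    IsUnit (moment 0 g) := by
  have := hg.map ((Polynomial.constantCoeff).comp (blowupChart (k := k)).toRingHom)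
  simpa [coeff_zero_blowupChart] using this

theorem isUnit_of_support_subset_zero {g : MvPolynomial (Fin 2) k} (hg : g ≠ 0)
    (h : ∀ e ∈ g.support, e 0 = 0 ∧ e 1 = 0) : IsUnit g := by
  have hC : g = C (coeff 0 g) := by
    ext e
    rw [coeff_C]
    split_ifs with he
    · rw [he]
    · by_contra hne
      obtain ⟨h0, h1⟩ := h e (mem_support_iff.2 hne)
      refine he (Finsupp.ext fun i => ?_)
      fin_cases i
      exacts [h0.symm, h1.symm]
  rw [hC]
  refine IsUnit.map C (isUnit_iff_ne_zero.2 fun h0 => hg ?_)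
  rw [hC, h0, C_0]

/-- The functional `e ↦ a e₀ + b e₁` on exponents. -/
def weight (a b : ℤ) : (Fin 2 →₀ ℕ) →+ ℤ where
  toFun e := a * e 0 + b * e 1
  map_zero' := by simp
  map_add' e e' := by
    simp only [Finsupp.add_apply]
    push_cast
    ring

theorem weight_apply (a b : ℤ) (e : Fin 2 →₀ ℕ) : weight a b e = a * e 0 + b * e 1 := rfl

theorem weight_le_zero_of_mul {g h : MvPolynomial (Fin 2) k} (hg : g ≠ 0)
    (h0 : 0 ∈ h.support) {w : (Fin 2 →₀ ℕ) →+ ℤ} (hw : ∀ e ∈ (g * h).support, w e ≤ 0) :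
    ∀ e ∈ g.support, w e ≤ 0 := by
  intro e he
  obtain ⟨p, hp, q, hq, hpmax, hqmax, hpq⟩ :=
    exists_max_weight_add_mem_support hg (support_nonempty.1 ⟨0, h0⟩) w
  have h1 := hpmax e he
  have h2 := hqmax 0 h0
  have h3 := hw _ hpq
  rw [map_zero] at h2
  rw [map_add] at h3
  linarith

theorem exists_eq_mul_of_slope {n N : ℕ} (hn : 2 ≤ n) {y : ℤ}
    (h : (4 * n - 3 : ℤ) * y = (4 * n - 1) * N) : ∃ j : ℕ, (N : ℤ) = j * (4 * n - 3) := by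
  have hcop : IsCoprime (4 * n - 3 : ℤ) (4 * n - 1) := ⟨2 * n - 1, -(2 * n - 2), by ring⟩
  obtain ⟨j, hj⟩ := hcop.dvd_of_dvd_mul_left ⟨y, h.symm⟩
  have hj0 : 0 ≤ j := by
    by_contra! hlt
    have := mul_neg_of_pos_of_neg (show (0 : ℤ) < 4 * n - 3 by omega) hlt
    omega
  lift j to ℕ using hj0
  exact ⟨j, by rw [hj, mul_comm]⟩

theorem isUnit_or_isUnit_of_mul [CharZero k] {n m : ℕ} (hn : 2 ≤ n)
    (hm : (m : ℤ) = n * (4 * n - 3)) {g h : MvPolynomial (Fin 2) k} (hgh : g * h ≠ 0)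
    (hleft : ∀ e ∈ (g * h).support, (4 * n - 3 : ℤ) * e 1 ≤ (4 * n - 1) * e 0)
    (hwidth : ∀ e ∈ (g * h).support, e 0 ≤ m)
    (hright : ∀ e ∈ (g * h).support,
      (4 * n + 1 : ℤ) * e 0 - 2 * e 1 ≤ n * (16 * n ^ 2 - 16 * n - 1) + 1)
    (hdvd : Polynomial.C (Polynomial.X - 1) ^ m ∣ blowupChart (g * h)) : IsUnit g ∨ IsUnit h := by
  have hn' : (2 : ℤ) ≤ n := by exact_mod_cast hn
  have hg := left_ne_zero_of_mul hgh
  have hh := right_ne_zero_of_mul hgh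
  have hmom := moment_zero_ne_zero hn hm hgh hleft hwidth hright hdvd
  have hmgh := hmom
  rw [moment_zero_mul] at hmgh
  have hmg := left_ne_zero_of_mul hmgh
  have hmh := right_ne_zero_of_mul hmgh
  have hzero : 0 ∈ (g * h).support := by
    have hC := eq_C_mul_of_X_pow_dvd_of_X_sub_one_pow_dvd (i := 0) (j := m)
      (by rw [zero_add]; exact natDegree_moment_le hwidth 0) (by simp)
      (by simpa using pow_sub_dvd_moment hdvd 0)
    have hne : (moment 0 (g * h)).coeff 0 ≠ 0 := by
      intro h0
      rw [hC, zero_add, Polynomial.coeff_C_mul, pow_zero, one_mul, Polynomial.coeff_zero_eq_eval_zero]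
        at h0
      have hz := (mul_eq_zero.1 h0).resolve_right (by simp)
      rw [zero_add, hz, Polynomial.C_0, zero_mul] at hC
      exact hmom hC
    obtain ⟨e, he, he0, -⟩ := exists_mem_support_of_coeff_moment_ne_zero hne
    have hl := hleft e he
    rw [he0] at hl
    have he1 : e 1 = 0 := by
      by_contra h1
      have := mul_pos (show (0 : ℤ) < 4 * n - 3 by linarith)
        (show (0 : ℤ) < e 1 by exact_mod_cast Nat.pos_of_ne_zero h1)
      simp at hl
      linarith
    have : e = 0 := by
      ext i
      fin_cases i
      exacts [he0, he1]
    rwa [← this]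
  have hzero' : coeff 0 g * coeff 0 h ≠ 0 := by
    simpa [← constantCoeff_eq] using mem_support_iff.1 hzero
  have hg0 : 0 ∈ g.support := mem_support_iff.2 (left_ne_zero_of_mul hzero')
  have hh0 : 0 ∈ h.support := mem_support_iff.2 (right_ne_zero_of_mul hzero')
  have hleft' : ∀ e ∈ (g * h).support, weight (-(4 * n - 1)) (4 * n - 3) e ≤ 0 := fun e he => by
    rw [weight_apply]
    linarith [hleft e he]
  have hleftg := weight_le_zero_of_mul hg hh0 hleft'
  have hlefth := weight_le_zero_of_mul hh hg0 (mul_comm g h ▸ hleft')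
  simp only [weight_apply] at hleftg hlefth
  obtain ⟨p, hp, q, hq, hpmax, hqmax, hpq⟩ :=
    exists_max_weight_add_mem_support hg hh (weight (4 * n + 1) (-2))
  have hrightpq : weight (4 * n + 1) (-2) p + weight (4 * n + 1) (-2) q ≤
      n * (16 * n ^ 2 - 16 * n - 1) + 1 := by
    rw [← map_add, weight_apply]
    linarith [hright _ hpq]
  generalize weight (4 * n + 1) (-2) p = Lg at hpmax hrightpq
  generalize weight (4 * n + 1) (-2) q = Lh at hqmax hrightpq
  simp only [weight_apply] at hpmax hqmax
  rw [map_mul] at hdvd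
  obtain ⟨N, N', hNN, hgN, hhN⟩ := exists_add_eq_of_pow_dvd_mul
    (Polynomial.prime_C_iff.2 (by simpa using Polynomial.prime_X_sub_C (1 : k))) hdvd
  have hdeg : g.degreeOf 0 + h.degreeOf 0 ≤ m := by
    rw [← degreeOf_mul_eq hg hh, degreeOf_le_iff]
    exact hwidth
  have hgdeg : ∀ e ∈ g.support, e 0 ≤ g.degreeOf 0 := degreeOf_le_iff.1 le_rfl
  have hhdeg : ∀ e ∈ h.support, e 0 ≤ h.degreeOf 0 := degreeOf_le_iff.1 le_rfl
  have h1 := natDegree_moment_le hgdeg 0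
  have h2 := natDegree_moment_le hhdeg 0
  have h3 := natTrailingDegree_add_le_natDegree hmg (by simpa using pow_sub_dvd_moment hgN 0)
  have h4 := natTrailingDegree_add_le_natDegree hmh (by simpa using pow_sub_dvd_moment hhN 0)
  have hgd : g.degreeOf 0 = N := by omega
  have hhd : h.degreeOf 0 = N' := by omega
  have hgd' : (moment 0 g).natDegree = N := by omega
  have hhd' : (moment 0 h).natDegree = N' := by omega
  rw [hgd] at hgdeg
  rw [hhd] at hhdeg
  obtain ⟨e, he, he0, -⟩ := exists_mem_support_of_coeff_moment_ne_zero
    (Polynomial.leadingCoeff_ne_zero.2 hmg)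
  obtain ⟨e', he', he0', -⟩ := exists_mem_support_of_coeff_moment_ne_zero
    (Polynomial.leadingCoeff_ne_zero.2 hmh)
  rw [hgd'] at he0
  rw [hhd'] at he0'
  have l1 := hleftg e he
  have l2 := hlefth e' he'
  have r1 := hpmax e he
  have r2 := hqmax e' he'
  rw [he0] at l1 r1
  rw [he0'] at l2 r2
  have hNN' : (N : ℤ) + N' = n * (4 * n - 3) := by rw [← hm]; exact_mod_cast hNN
  have hy : (n * (4 * n - 1) : ℤ) ≤ e 1 + e' 1 := by
    have : (n * (4 * n - 1) * 2 : ℤ) ≤ (e 1 + e' 1) * 2 + 1 := by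
      linear_combination r1 + r2 + hrightpq - (4 * n + 1) * hNN'
    omega
  have hy' : (4 * n - 3) * (n * (4 * n - 1) : ℤ) ≤ (4 * n - 3) * (e 1 + e' 1) :=
    mul_le_mul_of_nonneg_left hy (by linarith)
  have l1' : (4 * n - 3 : ℤ) * e 1 = (4 * n - 1) * N := by
    refine le_antisymm (by linarith) ?_
    linear_combination l2 + hy' + (4 * n - 1) * hNN'
  have l2' : (4 * n - 3 : ℤ) * e' 1 = (4 * n - 1) * N' := by
    refine le_antisymm (by linarith) ?_
    linear_combination l1 + hy' + (4 * n - 1) * hNN'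
  obtain ⟨j, hj⟩ := exists_eq_mul_of_slope hn l1'
  obtain ⟨j', hj'⟩ := exists_eq_mul_of_slope hn l2'
  have hjj : (j : ℤ) + j' = n := by
    rw [hj, hj', ← add_mul] at hNN'
    exact mul_right_cancel₀ (by omega) hNN'
  have hunit : ∀ {u : MvPolynomial (Fin 2) k} {i M : ℕ}, u ≠ 0 → moment 0 u ≠ 0 →
      (M : ℤ) = i * (4 * n - 3) →
      (∀ e ∈ u.support, -(4 * n - 1) * (e 0 : ℤ) + (4 * n - 3) * (e 1 : ℤ) ≤ 0) →
      (∀ e ∈ u.support, e 0 ≤ M) →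
      (1 ≤ i → ∀ e ∈ u.support,
        (4 * n + 1) * (e 0 : ℤ) + -2 * (e 1 : ℤ) ≤ i * (16 * n ^ 2 - 16 * n - 1)) →
      Polynomial.C (Polynomial.X - 1) ^ M ∣ blowupChart u → IsUnit u := by
    intro u i M hu hmu hM hl hw hr hd
    rcases Nat.eq_zero_or_pos i with rfl | hi
    · have hM0 : M = 0 := by simpa using hM
      refine isUnit_of_support_subset_zero hu fun e he => ?_
      have he0 : e 0 = 0 := by
        have := hw e he
        omega
      refine ⟨he0, ?_⟩
      by_contra h1
      have := mul_pos (show (0 : ℤ) < 4 * n - 3 by linarith)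
        (show (0 : ℤ) < e 1 by exact_mod_cast Nat.pos_of_ne_zero h1)
      have hle := hl e he
      rw [he0] at hle
      simp at hle
      linarith
    · exact absurd (moment_zero_eq_zero_of_support_subset hn hi hM
        (fun e he => by linarith [hl e he]) hw (fun e he => by linarith [hr hi e he]) hd) hmu
  have hsum : (j * (16 * n ^ 2 - 16 * n - 1) + j' * (16 * n ^ 2 - 16 * n - 1) : ℤ) + 1 =
      n * (16 * n ^ 2 - 16 * n - 1) + 1 := by
    rw [← add_mul, hjj]
  rcases le_or_gt Lg (j * (16 * n ^ 2 - 16 * n - 1)) with hL | hL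
  · exact Or.inl (hunit hg hmg hj hleftg hgdeg (fun _ e he => (hpmax e he).trans hL) hgN)
  · exact Or.inr (hunit hh hmh hj' hlefth hhdeg
      (fun _ e he => (hqmax e he).trans (by linarith)) hhN)

end Blowup

theorem linear_le_of_mem_convexHull {S : Set (ℝ × ℝ)} {a b c : ℝ}
    (hS : ∀ p ∈ S, a * p.1 + b * p.2 ≤ c) {p : ℝ × ℝ} (hp : p ∈ convexHull ℝ S) :
    a * p.1 + b * p.2 ≤ c := by
  have hlin : IsLinearMap ℝ fun p : ℝ × ℝ => a * p.1 + b * p.2 :=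
    ⟨fun p q => by simp only [Prod.fst_add, Prod.snd_add]; ring,
      fun r p => by simp only [Prod.smul_fst, Prod.smul_snd, smul_eq_mul]; ring⟩
  exact convexHull_min hS (convex_halfSpace_le hlin c) hp

theorem stmt7 (k : Type*) [Field k] [IsAlgClosed k] [CharZero k]
    (K : ℤ) (hK : 5 ≤ K) (hKodd : Odd K)
    (a c d : ℤ) (m : ℕ) (ha : a = 2 * K - 3) (hc : c = 4 * K ^ 2 - 16 * K + 11)
    (hd : d = 2 * K - 5)
    (hm : 2 * (m : ℤ) = 2 * K ^ 2 - 7 * K + 5)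
    (f : MvPolynomial (Fin 2) k) (hf0 : f ≠ 0)
    (hsupp : ∀ e ∈ f.support,
      ((e 0 : ℝ), (e 1 : ℝ)) ∈ convexHull ℝ
        ({((0 : ℝ), (0 : ℝ)), ((m : ℝ) - (K : ℝ) + 2, 0),
          (((K : ℝ) - 1) / 2 + 1 / (c : ℝ)) • ((d : ℝ), (a : ℝ))} : Set (ℝ × ℝ)))
    (hvan : f ∈ (Ideal.span {X 0 - 1, X 1 - 1} : Ideal (MvPolynomial (Fin 2) k)) ^ m) :
    Irreducible f := by
  obtain ⟨n, rfl⟩ := hKodd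
  lift n to ℕ using by omega
  have hn : 2 ≤ n := by omega
  have hn' : (2 : ℤ) ≤ n := by exact_mod_cast hn
  have hm' : (m : ℤ) = n * (4 * n - 3) := by linarith
  have hmR : (m : ℝ) = n * (4 * n - 3) := by exact_mod_cast congrArg (Int.cast : ℤ → ℝ) hm'
  have hnR : (2 : ℝ) ≤ n := by exact_mod_cast hn
  have haR : (a : ℝ) = 4 * n - 1 := by rw [ha]; push_cast; ring
  have hdR : (d : ℝ) = 4 * n - 3 := by rw [hd]; push_cast; ring
  have hcR : (c : ℝ) = 16 * n ^ 2 - 16 * n - 1 := by rw [hc]; push_cast; ring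
  have hc0 : (0 : ℝ) < 16 * n ^ 2 - 16 * n - 1 := by nlinarith
  rw [haR, hdR, hcR] at hsupp
  have hleft : ∀ e ∈ f.support, (4 * n - 3 : ℤ) * e 1 ≤ (4 * n - 1) * e 0 := by
    intro e he
    have := linear_le_of_mem_convexHull (a := -(4 * n - 1)) (b := 4 * n - 3) (c := 0) (by
      rintro _ (rfl | rfl | rfl)
      · simp
      · rw [hmR]
        push_cast
        nlinarith
      · simp only [Prod.smul_fst, Prod.smul_snd, smul_eq_mul]
        exact le_of_eq (by ring)) (hsupp e he)
    have h2 : (4 * n - 3 : ℝ) * e 1 ≤ (4 * n - 1) * e 0 := by linarith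
    exact_mod_cast h2
  have hright : ∀ e ∈ f.support,
      (4 * n + 1 : ℤ) * e 0 - 2 * e 1 ≤ n * (16 * n ^ 2 - 16 * n - 1) + 1 := by
    intro e he
    have := linear_le_of_mem_convexHull (a := 4 * n + 1) (b := -2)
      (c := n * (16 * n ^ 2 - 16 * n - 1) + 1) (by
      rintro _ (rfl | rfl | rfl)
      · simp
        nlinarith
      · rw [hmR]
        push_cast
        exact le_of_eq (by ring)
      · simp only [Prod.smul_fst, Prod.smul_snd, smul_eq_mul]
        push_cast
        exact le_of_eq (by linear_combination one_div_mul_cancel hc0.ne')) (hsupp e he)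
    have h2 : (4 * n + 1 : ℝ) * e 0 - 2 * e 1 ≤ n * (16 * n ^ 2 - 16 * n - 1) + 1 := by linarith
    exact_mod_cast h2
  have hwidth : ∀ e ∈ f.support, e 0 ≤ m := by
    intro e he
    have h1 := hleft e he
    have h2 := hright e he
    by_contra! h
    have h3 : (n * (4 * n - 3) : ℤ) + 1 ≤ e 0 := by
      rw [← hm']
      exact_mod_cast h
    have h4 : (0 : ℤ) ≤ 16 * n ^ 2 - 16 * n - 1 := by nlinarith
    have h5 := mul_le_mul_of_nonneg_left h3 h4
    have h6 := mul_le_mul_of_nonneg_left h2 (show (0 : ℤ) ≤ 4 * n - 3 by linarith)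
    nlinarith
  have hdvd := pow_dvd_blowupChart hvan
  refine ⟨fun hu => ?_, fun g h hgh => ?_⟩
  · have hmu := isUnit_of_dvd_unit (pow_sub_dvd_moment hdvd 0) (isUnit_moment_zero hu)
    have hm0 : m - 0 ≠ 0 := by
      zify
      simp only [Nat.sub_zero, hm']
      nlinarith
    exact (Polynomial.prime_X_sub_C (1 : k)).not_isUnit
      (by simpa using (isUnit_pow_iff hm0).1 hmu)
  · subst hgh
    exact isUnit_or_isUnit_of_mul hn hm' hf0 hleft hwidth hright hdvd
end
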